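/- arXiv:1202.5265 — 3 statements merged into one kernel-verified Lean document; each statement's English description precedes it below -/
import Mathlib

section
/- Let N be a positive integer and let B = ⌊ [SL₂(ℤ) : Γ₀(N)]/6 − ([SL₂(ℤ) : Γ₀(N)] − 1)/N ⌋ (the Sturm bound for Γ₀(N) in weight 2). Let h and g be cusp forms of weight 2 for Γ₀(N) whose q-expansion coefficients aₙ(h) and aₙ(g) all lie in ℤ, and let p be a prime. If aₙ(h) ≡ aₙ(g) (mod p) for all n ≤ B, then aₙ(h) ≡ aₙ(g) (mod p) for all n. -/
open UpperHalfPlane Complex CongruenceSubgroup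

section

open scoped ModularForm MatrixGroups Manifold
open PowerSeries (coeff constantCoeff)

/-- `E₄ = 1 + 240 ∑ σ₃(n) qⁿ`, as a power series over `ℤ`. -/
lemma qExpansion_E₄_eq_map :
    qExpansion 1 ModularForm.E₄ = PowerSeries.map (Int.castRingHom ℂ)
      (1 + 240 * PowerSeries.mk fun n ↦ (ArithmeticFunction.sigma 3 n : ℤ)) := by
  ext n
  rw [EisensteinSeries.E_qExpansion_coeff _ ⟨2, rfl⟩, PowerSeries.coeff_map, map_add,
    show (240 : PowerSeries ℤ) = PowerSeries.C 240 from rfl, PowerSeries.coeff_C_mul,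
    PowerSeries.coeff_one, PowerSeries.coeff_mk]
  rcases eq_or_ne n 0 with rfl | hn
  · simp
  · norm_num [hn, bernoulli_eq_bernoulli'_of_ne_one]

lemma bernoulli_six : bernoulli 6 = 1 / 42 := by
  have h5 : bernoulli' 5 = 0 := by
    rw [bernoulli'_def]
    norm_num [Finset.sum_range_succ, Nat.choose]
  rw [bernoulli_eq_bernoulli'_of_ne_one (by norm_num), bernoulli'_def]
  norm_num [Finset.sum_range_succ, Nat.choose, h5]

/-- `E₆ = 1 - 504 ∑ σ₅(n) qⁿ`, as a power series over `ℤ`. -/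
lemma qExpansion_E₆_eq_map :
    qExpansion 1 ModularForm.E₆ = PowerSeries.map (Int.castRingHom ℂ)
      (1 - 504 * PowerSeries.mk fun n ↦ (ArithmeticFunction.sigma 5 n : ℤ)) := by
  ext n
  rw [EisensteinSeries.E_qExpansion_coeff _ ⟨3, rfl⟩, PowerSeries.coeff_map, map_sub,
    show (504 : PowerSeries ℤ) = PowerSeries.C 504 from rfl, PowerSeries.coeff_C_mul,
    PowerSeries.coeff_one, PowerSeries.coeff_mk]
  rcases eq_or_ne n 0 with rfl | hn
  · simp
  · norm_num [hn, bernoulli_six]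

lemma twelve_dvd_five_sigma_three_add_seven_sigma_five (n : ℕ) :
    (12 : ℤ) ∣ 5 * ArithmeticFunction.sigma 3 n + 7 * ArithmeticFunction.sigma 5 n := by
  simp only [ArithmeticFunction.sigma_apply, Nat.cast_sum, Finset.mul_sum,
    ← Finset.sum_add_distrib]
  refine Finset.dvd_sum fun d _ ↦ ?_
  refine (ZMod.intCast_zmod_eq_zero_iff_dvd _ 12).mp ?_
  push_cast
  generalize (d : ZMod 12) = x
  revert x
  decide

/-- The discriminant has a `q`-expansion over `ℤ` which is `q` times a unit. -/
lemma exists_qExpansion_discriminant_eq_map :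
    ∃ u : (PowerSeries ℤ)ˣ, qExpansion 1 ModularForm.discriminant =
      PowerSeries.map (Int.castRingHom ℂ) (PowerSeries.X * (u : PowerSeries ℤ)) := by
  choose c hc using twelve_dvd_five_sigma_three_add_seven_sigma_five
  set A : PowerSeries ℤ := PowerSeries.mk fun n ↦ (ArithmeticFunction.sigma 3 n : ℤ)
  set B : PowerSeries ℤ := PowerSeries.mk fun n ↦ (ArithmeticFunction.sigma 5 n : ℤ)
  have hAB : 5 * A + 7 * B = 12 * PowerSeries.mk c := by
    ext n
    rw [show (12 : PowerSeries ℤ) = PowerSeries.C 12 from rfl,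
      show (5 : PowerSeries ℤ) = PowerSeries.C 5 from rfl,
      show (7 : PowerSeries ℤ) = PowerSeries.C 7 from rfl]
    simp only [map_add, PowerSeries.coeff_C_mul, PowerSeries.coeff_mk, A, B, hc]
  set D : PowerSeries ℤ := PowerSeries.mk c + 100 * A ^ 2 + 8000 * A ^ 3 - 147 * B ^ 2
  have hD : qExpansion 1 ModularForm.discriminant = PowerSeries.map (Int.castRingHom ℂ) D := by
    have h : (1728 : ℂ) • qExpansion 1 ModularForm.discriminant =
        qExpansion 1 ModularForm.E₄ ^ 3 - qExpansion 1 ModularForm.E₆ ^ 2 := by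
      have hE : ((1728 : ℂ) • CuspForm.discriminant : ℍ → ℂ) =
          ⇑(ModularForm.E₄.pow 3) - ⇑(ModularForm.E₆.pow 2) := by
        ext z
        have h4 : (ModularForm.E₄.pow 3) z = ModularForm.E₄ z ^ 3 := by
          rw [ModularForm.coe_pow, Pi.pow_apply]
        have h6 : (ModularForm.E₆.pow 2) z = ModularForm.E₆ z ^ 2 := by
          rw [ModularForm.coe_pow, Pi.pow_apply]
        simp [ModularForm.discriminant_eq_E₄_cube_sub_E₆_sq z, h4, h6]
        ring
      have hE' := congrArg (qExpansion 1) hE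
      rwa [ModularForm.qExpansion_smul one_pos one_mem_strictPeriods_SL,
        ModularForm.qExpansion_sub one_pos one_mem_strictPeriods_SL,
        ModularForm.qExpansion_pow one_pos one_mem_strictPeriods_SL,
        ModularForm.qExpansion_pow one_pos one_mem_strictPeriods_SL] at hE'
    rw [qExpansion_E₄_eq_map, qExpansion_E₆_eq_map, ← map_pow, ← map_pow, ← map_sub,
      show (1 + 240 * A) ^ 3 - (1 - 504 * B) ^ 2 = 1728 * D by
        linear_combination 144 * hAB, map_mul, map_ofNat,
      show (1728 : PowerSeries ℂ) = PowerSeries.C 1728 from rfl, ← PowerSeries.smul_eq_C_mul] at h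
    exact smul_right_injective _ (by norm_num : (1728 : ℂ) ≠ 0) h
  have h0 : coeff 0 D = 0 := by
    have := congrArg (coeff 0) hD
    rw [← CuspForm.coe_discriminant,
      CuspFormClass.qExpansion_coeff_zero CuspForm.discriminant one_pos one_mem_strictPeriods_SL,
      PowerSeries.coeff_map] at this
    simpa using this.symm
  have h1 : coeff 1 D = 1 := by
    have := congrArg (coeff 1) hD
    rw [ModularForm.discriminant_qExpansion_coeff_one, PowerSeries.coeff_map, eq_intCast] at this
    exact_mod_cast this.symm
  obtain ⟨v, hv⟩ := PowerSeries.X_dvd_iff.mpr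
    ((PowerSeries.coeff_zero_eq_constantCoeff_apply D).symm.trans h0)
  have hv0 : IsUnit v := by
    rw [PowerSeries.isUnit_iff_constantCoeff, ← PowerSeries.coeff_zero_eq_constantCoeff_apply]
    rw [hv, show 1 = 0 + 1 from rfl, PowerSeries.coeff_succ_X_mul] at h1
    simp [h1]
  exact ⟨hv0.unit, by rw [hD, hv, hv0.unit_spec]⟩

/-- In each even weight `k ≠ 2` there is a level one form with integral `q`-expansion and
constant term `1`. -/
lemma exists_levelOne_integral_constantCoeff_eq_one {k : ℕ} (hk : Even k) (hk2 : k ≠ 2) :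
    ∃ (F : ModularForm 𝒮ℒ (k : ℤ)) (w : PowerSeries ℤ),
      qExpansion 1 F = PowerSeries.map (Int.castRingHom ℂ) w ∧ coeff 0 w = 1 := by
  obtain ⟨a, b, rfl⟩ : ∃ a b, k = a * 4 + b * 6 := by
    obtain ⟨r, rfl⟩ := hk
    rcases Nat.even_or_odd r with ⟨s, rfl⟩ | ⟨s, rfl⟩
    · exact ⟨s, 0, by ring⟩
    · exact ⟨s - 1, 1, by omega⟩
  refine ⟨ModularForm.mcast (by push_cast; ring)
    ((ModularForm.E₄.pow a).mul (ModularForm.E₆.pow b)),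
    (1 + 240 * PowerSeries.mk fun n ↦ (ArithmeticFunction.sigma 3 n : ℤ)) ^ a *
      (1 - 504 * PowerSeries.mk fun n ↦ (ArithmeticFunction.sigma 5 n : ℤ)) ^ b, ?_, ?_⟩
  · rw [ModularForm.qExpansion_mcast,
      ModularForm.qExpansion_mul one_pos one_mem_strictPeriods_SL,
      ModularForm.qExpansion_pow one_pos one_mem_strictPeriods_SL,
      ModularForm.qExpansion_pow one_pos one_mem_strictPeriods_SL,
      qExpansion_E₄_eq_map, qExpansion_E₆_eq_map, ← map_pow, ← map_pow, ← map_mul]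
  · simp

lemma PowerSeries.coeff_map_intCast_mul_mem {R : Type*} [CommRing R] (I : AddSubgroup R)
    (w : PowerSeries ℤ) {P : PowerSeries R} {M : ℕ} (hP : ∀ n ≤ M, coeff n P ∈ I) :
    ∀ n ≤ M, coeff n (PowerSeries.map (Int.castRingHom R) w * P) ∈ I := by
  intro n hn
  rw [PowerSeries.coeff_mul]
  refine I.sum_mem fun x hx ↦ ?_
  rw [PowerSeries.coeff_map, eq_intCast, ← zsmul_eq_mul]
  have := Finset.HasAntidiagonal.mem_antidiagonal.mp hx
  exact I.zsmul_mem (hP _ (by lia)) _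

/-- Sturm's theorem in level one, for coefficients in an arbitrary additive subgroup of `ℂ`. -/
theorem ModularForm.levelOne_coeff_mem (I : AddSubgroup ℂ) {k : ℕ} (F : ModularForm 𝒮ℒ (k : ℤ))
    (hF : ∀ n ≤ k / 12, coeff n (qExpansion 1 F) ∈ I) (n : ℕ) :
    coeff n (qExpansion 1 F) ∈ I := by
  induction k using Nat.strong_induction_on generalizing n with | _ k ih
  rcases eq_or_ne F 0 with rfl | hF0
  · rw [FunLike.coe_zero, qExpansion_zero]
    simp
  have hk : Even k := by
    by_contra h
    exact hF0 (levelOne_odd_weight_eq_zero (by simpa using h) F)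
  have hk2 : k ≠ 2 := by
    rintro rfl
    exact hF0 (rank_zero_iff_forall_zero.mp levelOne_weight_two_rank_zero F)
  obtain ⟨E, w, hE, hw⟩ := exists_levelOne_integral_constantCoeff_eq_one hk hk2
  set a := coeff 0 (qExpansion 1 F)
  have haI : a ∈ I := hF 0 (Nat.zero_le _)
  obtain ⟨H, hH⟩ : ∃ H, H = F - a • E := ⟨_, rfl⟩
  have hG : qExpansion 1 H = qExpansion 1 F - a • qExpansion 1 E := by
    rw [hH, FunLike.coe_sub, ModularForm.qExpansion_sub one_pos one_mem_strictPeriods_SL,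
      FunLike.coe_smul, ModularForm.qExpansion_smul one_pos one_mem_strictPeriods_SL]
  have haE (n : ℕ) : coeff n (a • qExpansion 1 E) ∈ I := by
    rw [hE, PowerSeries.coeff_smul, PowerSeries.coeff_map, eq_intCast, smul_eq_mul, mul_comm,
      ← zsmul_eq_mul]
    exact I.zsmul_mem haI _
  have hG0 : coeff 0 (qExpansion 1 H) = 0 := by
    rw [hG, map_sub, PowerSeries.coeff_smul, hE, PowerSeries.coeff_map, hw]
    simp [a]
  have hGI (n : ℕ) (hn : n ≤ k / 12) : coeff n (qExpansion 1 H) ∈ I := by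
    rw [hG, map_sub]
    exact I.sub_mem (hF n hn) (haE n)
  suffices h : ∀ n, coeff n (qExpansion 1 H) ∈ I by
    have := I.add_mem (h n) (haE n)
    rwa [hG, map_sub, sub_add_cancel] at this
  have hfac := qExpansion_eq_qExpansion_discriminant_mul H hG0
  set G := CuspForm.discriminantEquiv (toCuspForm H hG0)
  obtain ⟨u, hu⟩ := exists_qExpansion_discriminant_eq_map
  have hGmem : ∀ n, coeff n (qExpansion 1 G) ∈ I := by
    rcases lt_or_ge k 12 with hk12 | hk12
    · have : G = 0 := rank_zero_iff_forall_zero.mp (levelOne_neg_weight_rank_zero (by lia)) G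
      rw [this, FunLike.coe_zero, qExpansion_zero]
      simp
    · have hcast : (k : ℤ) - 12 = ((k - 12 : ℕ) : ℤ) := by lia
      refine ih (k - 12) (by lia) (mcast hcast G) fun n hn ↦ ?_
      rw [ModularForm.qExpansion_mcast]
      have key : ∀ n ≤ (k - 12) / 12, coeff n
          (PowerSeries.map (Int.castRingHom ℂ) u * qExpansion 1 G) ∈ I := by
        intro n hn
        have := hGI (n + 1) (by lia)
        rwa [hfac, hu, map_mul (PowerSeries.map _), PowerSeries.map_X, mul_assoc,
          PowerSeries.coeff_succ_X_mul] at this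
      have := PowerSeries.coeff_map_intCast_mul_mem I (↑u⁻¹ : PowerSeries ℤ) key n hn
      rwa [← mul_assoc, ← map_mul, Units.inv_mul, map_one, one_mul] at this
  intro n
  rw [hfac, hu]
  exact PowerSeries.coeff_map_intCast_mul_mem I _ (fun m _ ↦ hGmem m) n le_rfl

lemma Multiset.esymm_cons_succ {R : Type*} [CommSemiring R] (a : R) (s : Multiset R) (j : ℕ) :
    (a ::ₘ s).esymm (j + 1) = s.esymm (j + 1) + a * s.esymm j := by
  simp [Multiset.esymm, Multiset.powersetCard_cons, Multiset.sum_map_mul_left]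

section esymm
open SlashInvariantForm Asymptotics
open scoped Pointwise

variable {𝒢 : Subgroup (GL (Fin 2) ℝ)} (ℋ : Subgroup (GL (Fin 2) ℝ)) {F : Type*} (f : F)
  [FunLike F ℍ ℂ] {k : ℤ} [𝒢.IsFiniteRelIndex ℋ]

/-- The `j`-th elementary symmetric polynomial in the translates of a modular form, as a modular
form. -/
noncomputable def ModularForm.esymm [ℋ.HasDetPlusMinusOne] [ModularFormClass F 𝒢 k] (j : ℕ) :
    ModularForm ℋ (k * j) where
  toFun := let := Fintype.ofFinite (ℋ ⧸ 𝒢.subgroupOf ℋ)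
    ∑ t ∈ (Finset.univ : Finset (ℋ ⧸ 𝒢.subgroupOf ℋ)).powersetCard j, ∏ q ∈ t, quotientFunc f q
  slash_action_eq' h hh := by
    let := Fintype.ofFinite (ℋ ⧸ 𝒢.subgroupOf ℋ)
    rw [SlashAction.sum_slash, ← Finset.esymm_map_val, ← Multiset.map_univ_val_equiv
      (MulAction.toPerm (⟨h, hh⟩ : ℋ)⁻¹), Multiset.map_map, Finset.esymm_map_val]
    refine Finset.sum_congr rfl fun t ht ↦ ?_
    rw [← (Finset.mem_powersetCard.mp ht).2, ModularForm.prod_slash]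
    simp [quotientFunc_smul f hh, Subgroup.HasDetPlusMinusOne.abs_det hh,
      -Matrix.GeneralLinearGroup.val_det_apply]
  holo' := .sum fun t _ ↦ .prod fun q _ ↦
    Quotient.inductionOn q fun ⟨r, hr⟩ ↦ (translate f r⁻¹).holo'
  bdd_at_cusps' h γ := by
    rintro rfl
    let := Fintype.ofFinite (ℋ ⧸ 𝒢.subgroupOf ℋ)
    rw [IsBoundedAtImInfty, Filter.BoundedAtFilter, SlashAction.sum_slash]
    refine .sum fun t ht ↦ ?_
    rw [← (Finset.mem_powersetCard.mp ht).2, ModularForm.prod_slash]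
    apply Asymptotics.IsBigO.const_smul_left
    rw [show (1 : ℍ → ℝ) = (fun x ↦ ∏ q ∈ t, 1) by ext; simp, Finset.prod_fn]
    refine .finsetProd fun q _ ↦ Quotient.inductionOn q fun ⟨r, hr⟩ ↦
      (translate f _).bdd_at_cusps' ?_ γ rfl
    simpa using h.of_isFiniteRelIndex_conj hr

/-- The `j`-th elementary symmetric polynomial in the translates of a modular form other than
the form itself. -/
noncomputable def esymmErase [SlashInvariantFormClass F 𝒢 k] (j : ℕ) : ℍ → ℂ :=
  let := Fintype.ofFinite (ℋ ⧸ 𝒢.subgroupOf ℋ)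
  let := Classical.decEq (ℋ ⧸ 𝒢.subgroupOf ℋ)
  ((Finset.univ.erase (⟦1⟧ : ℋ ⧸ 𝒢.subgroupOf ℋ)).val.map (quotientFunc f)).esymm j

@[simp] lemma esymmErase_zero [SlashInvariantFormClass F 𝒢 k] :
    esymmErase (𝒢 := 𝒢) ℋ f 0 = 1 := by
  simp [esymmErase, Multiset.esymm]

lemma esymmErase_eq_zero [SlashInvariantFormClass F 𝒢 k] {j : ℕ}
    (hj : Nat.card (ℋ ⧸ 𝒢.subgroupOf ℋ) ≤ j) : esymmErase (𝒢 := 𝒢) ℋ f j = 0 := by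
  let := Fintype.ofFinite (ℋ ⧸ 𝒢.subgroupOf ℋ)
  let := Classical.decEq (ℋ ⧸ 𝒢.subgroupOf ℋ)
  rw [Nat.card_eq_fintype_card] at hj
  have : 0 < Fintype.card (ℋ ⧸ 𝒢.subgroupOf ℋ) := Fintype.card_pos_iff.mpr ⟨⟦1⟧⟩
  rw [esymmErase, Finset.esymm_map_val, Finset.powersetCard_eq_empty.mpr, Finset.sum_empty]
  rw [Finset.card_erase_of_mem (Finset.mem_univ _), Finset.card_univ]
  lia

lemma ModularForm.coe_esymm_zero [ℋ.HasDetPlusMinusOne] [ModularFormClass F 𝒢 k] :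
    (ModularForm.esymm (𝒢 := 𝒢) ℋ f 0 : ℍ → ℂ) = 1 := by
  change ∑ t ∈ _, _ = _
  simp

lemma esymmErase_succ [ℋ.HasDetPlusMinusOne] [ModularFormClass F 𝒢 k] (j : ℕ) :
    esymmErase (𝒢 := 𝒢) ℋ f (j + 1) =
      ModularForm.esymm (𝒢 := 𝒢) ℋ f (j + 1) - f * esymmErase (𝒢 := 𝒢) ℋ f j := by
  let := Fintype.ofFinite (ℋ ⧸ 𝒢.subgroupOf ℋ)
  let := Classical.decEq (ℋ ⧸ 𝒢.subgroupOf ℋ)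
  have h : (ModularForm.esymm (𝒢 := 𝒢) ℋ f (j + 1) : ℍ → ℂ) =
      (Finset.univ.val.map (quotientFunc (𝒢 := 𝒢) (ℋ := ℋ) f)).esymm (j + 1) :=
    (Finset.esymm_map_val _ _ _).symm
  have h1 : quotientFunc (𝒢 := 𝒢) (ℋ := ℋ) f ⟦1⟧ = f := by simp
  rw [h, ← Multiset.cons_erase (Finset.mem_univ_val (⟦1⟧ : ℋ ⧸ 𝒢.subgroupOf ℋ)),
    Multiset.map_cons, Multiset.esymm_cons_succ, h1]
  exact (add_sub_cancel_right _ _).symm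

lemma esymmErase_isBigO [SlashInvariantFormClass F 𝒢 k] {l : Filter ℍ} {g : ℍ → ℝ}
    (hg : ∀ q : ℋ ⧸ 𝒢.subgroupOf ℋ, quotientFunc f q =O[l] g) (j : ℕ) :
    esymmErase (𝒢 := 𝒢) ℋ f j =O[l] fun τ ↦ g τ ^ j := by
  rw [esymmErase, Finset.esymm_map_val]
  refine .sum fun t ht ↦ ?_
  have h : (fun τ ↦ g τ ^ j) = fun τ ↦ ∏ _q ∈ t, g τ := by
    simp [(Finset.mem_powersetCard.mp ht).2]
  rw [h, Finset.prod_fn]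
  exact .finsetProd fun q _ ↦ hg q

lemma esymmErase_mdifferentiable [ModularFormClass F 𝒢 k] (j : ℕ) :
    MDiff (esymmErase (𝒢 := 𝒢) ℋ f j) := by
  rw [esymmErase, Finset.esymm_map_val]
  exact .sum fun t _ ↦ .prod fun q _ ↦
    Quotient.inductionOn q fun ⟨r, hr⟩ ↦ (ModularForm.translate f r⁻¹).holo'

variable [ℋ.HasDetPlusMinusOne]

lemma esymmErase_periodic [ModularFormClass F 𝒢 k] {x : ℝ} (h𝒢 : x ∈ 𝒢.strictPeriods)
    (hℋ : x ∈ ℋ.strictPeriods) (j : ℕ) :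
    Function.Periodic (esymmErase (𝒢 := 𝒢) ℋ f j ∘ ofComplex) x := by
  induction j with
  | zero => simp [Function.Periodic]
  | succ j ih =>
    rw [esymmErase_succ]
    exact (SlashInvariantFormClass.periodic_comp_ofComplex (ModularForm.esymm ℋ f (j + 1)) hℋ).sub
      ((SlashInvariantFormClass.periodic_comp_ofComplex f h𝒢).mul ih)

lemma esymmErase_isBoundedAtImInfty [ModularFormClass F 𝒢 k] {x : ℝ} (hx : 0 < x)
    (h𝒢 : x ∈ 𝒢.strictPeriods) (hℋ : x ∈ ℋ.strictPeriods) (j : ℕ) :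
    IsBoundedAtImInfty (esymmErase (𝒢 := 𝒢) ℋ f j) := by
  have : Fact (IsCusp OnePoint.infty 𝒢) := ⟨𝒢.isCusp_of_mem_strictPeriods hx h𝒢⟩
  have : Fact (IsCusp OnePoint.infty ℋ) := ⟨ℋ.isCusp_of_mem_strictPeriods hx hℋ⟩
  induction j with
  | zero => exact (esymmErase_zero ℋ f).symm ▸ Filter.const_boundedAtFilter _ (1 : ℂ)
  | succ j ih =>
    rw [esymmErase_succ]
    exact (ModularFormClass.bdd_at_infty (ModularForm.esymm ℋ f (j + 1))).sub
      ((ModularFormClass.bdd_at_infty f).mul ih)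

lemma qExpansion_esymmErase_succ [ModularFormClass F 𝒢 k] {x : ℝ} (hx : 0 < x)
    (h𝒢 : x ∈ 𝒢.strictPeriods) (hℋ : x ∈ ℋ.strictPeriods) (j : ℕ) :
    qExpansion x (esymmErase (𝒢 := 𝒢) ℋ f (j + 1)) =
      qExpansion x (ModularForm.esymm (𝒢 := 𝒢) ℋ f (j + 1)) -
        qExpansion x f * qExpansion x (esymmErase (𝒢 := 𝒢) ℋ f j) := by
  have hs := analyticAt_cuspFunction_zero hx (esymmErase_periodic ℋ f h𝒢 hℋ j)
    (esymmErase_mdifferentiable ℋ f j) (esymmErase_isBoundedAtImInfty ℋ f hx h𝒢 hℋ j)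
  have hf := ModularFormClass.analyticAt_cuspFunction_zero f hx h𝒢
  have he := ModularFormClass.analyticAt_cuspFunction_zero
    (ModularForm.esymm (𝒢 := 𝒢) ℋ f (j + 1)) hx hℋ
  have hfs : AnalyticAt ℂ (cuspFunction x (f * esymmErase (𝒢 := 𝒢) ℋ f j)) 0 := by
    rw [cuspFunction_mul hf.continuousAt hs.continuousAt]
    exact hf.mul hs
  rw [esymmErase_succ, qExpansion_sub he hfs, qExpansion_mul hf hs]

end esymm

/-- A holomorphic function decaying like `exp (-2π c Im τ)` has vanishing `q`-expansion coefficients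
below `c`. -/
lemma UpperHalfPlane.qExpansion_coeff_eq_zero_of_isBigO {f : ℍ → ℂ}
    (hfper : Function.Periodic (f ∘ ofComplex) 1) (hfhol : MDiff f) (hfbdd : IsBoundedAtImInfty f)
    {c : ℝ} (hf : f =O[atImInfty] fun τ ↦ Real.exp (-2 * Real.pi * c * τ.im)) {n : ℕ}
    (hn : (n : ℝ) < c) : coeff n (qExpansion 1 f) = 0 := by
  obtain ⟨C, hC⟩ := hf.bound
  obtain ⟨T, hT⟩ := atImInfty_mem _ |>.mp hC
  have hbound : ∀ᶠ t : ℝ in Filter.atTop, ‖coeff n (qExpansion 1 f)‖ ≤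
      C * Real.exp (-(2 * Real.pi * (c - n) * t)) := by
    filter_upwards [Filter.eventually_ge_atTop T, Filter.eventually_gt_atTop 0] with t htT ht
    rw [qExpansion_coeff_eq_intervalIntegral one_pos (by simpa using hfper) hfhol hfbdd n ht]
    have := intervalIntegral.norm_integral_le_of_norm_le_const (a := 0) (b := 1)
      (f := fun u : ℝ ↦ 1 / Function.Periodic.qParam 1 (u + t * I) ^ n *
        f ⟨u + t * I, by simpa using ht⟩) (C := C * Real.exp (-(2 * Real.pi * (c - n) * t))) ?_
    · simpa using this
    intro u _
    have h1 := hT ⟨u + t * I, by simpa using ht⟩ (by simpa [UpperHalfPlane.im] using htT)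
    have h2 : (UpperHalfPlane.im ⟨u + t * I, by simpa using ht⟩) = t := by
      simp [UpperHalfPlane.im]
    simp only [Set.mem_ofPred_eq, h2, Real.norm_eq_abs, Real.abs_exp] at h1
    have h3 : ‖Function.Periodic.qParam 1 (u + t * I)‖ = Real.exp (-2 * Real.pi * t / 1) := by
      simp [Function.Periodic.norm_qParam]
    rw [norm_mul, norm_div, norm_one, norm_pow, h3]
    calc _ ≤ 1 / Real.exp (-2 * Real.pi * t / 1) ^ n * (C * Real.exp (-2 * Real.pi * c * t)) := by
          gcongr
      _ = _ := by
        rw [← Real.exp_nat_mul, one_div, ← Real.exp_neg, mul_left_comm, ← Real.exp_add]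
        ring_nf
  have hlim : Filter.Tendsto (fun t : ℝ ↦ C * Real.exp (-(2 * Real.pi * (c - n) * t)))
      Filter.atTop (nhds 0) := by
    rw [← mul_zero C]
    refine (Real.tendsto_exp_neg_atTop_nhds_zero.comp ?_).const_mul C
    exact Filter.tendsto_id.const_mul_atTop (by have := Real.pi_pos; nlinarith)
  exact norm_le_zero_iff.mp (ge_of_tendsto hlim hbound)

open scoped Pointwise in
lemma natCast_mem_strictPeriods_conj_Gamma0 (N : ℕ) {r : GL (Fin 2) ℝ} (hr : r ∈ 𝒮ℒ) :
    (N : ℝ) ∈ (ConjAct.toConjAct r • (Gamma0 N : Subgroup (GL (Fin 2) ℝ))).strictPeriods := by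
  obtain ⟨γ, rfl⟩ := hr
  obtain ⟨t, ht⟩ : ∃ t : SL(2, ℤ), (t : Matrix (Fin 2) (Fin 2) ℤ) = !![1, (N : ℤ); 0, 1] :=
    ⟨_, ModularGroup.coe_T_zpow N⟩
  have hT : t ∈ CongruenceSubgroup.Gamma N := by
    simp [ht]
  have hγ : γ⁻¹ * t * γ ∈ Gamma0 N := by
    have h := (Gamma_normal N).conj_mem _ hT γ⁻¹
    rw [inv_inv, Gamma_mem] at h
    exact Gamma0_mem.mpr h.2.2.1
  rw [Subgroup.mem_strictPeriods_iff, Subgroup.mem_pointwise_smul_iff_inv_smul_mem,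
    ← ConjAct.toConjAct_inv, ConjAct.toConjAct_smul]
  refine ⟨_, hγ, ?_⟩
  rw [map_mul, map_mul, map_inv, inv_inv]
  congr 2
  ext i j
  fin_cases i <;> fin_cases j <;> simp [ht]

lemma one_mem_strictPeriods_Gamma0 (N : ℕ) :
    (1 : ℝ) ∈ (Gamma0 N : Subgroup (GL (Fin 2) ℝ)).strictPeriods := by
  rw [strictPeriods_Gamma0]
  exact AddSubgroup.mem_zmultiples 1

lemma CuspForm.quotientFunc_isBigO_Gamma0 {N : ℕ} (hN : 0 < N) {k : ℤ} (f : CuspForm (Gamma0 N) k)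
    (q : 𝒮ℒ ⧸ (Gamma0 N : Subgroup (GL (Fin 2) ℝ)).subgroupOf 𝒮ℒ) :
    SlashInvariantForm.quotientFunc f q =O[atImInfty]
      fun τ ↦ Real.exp (-2 * Real.pi * τ.im / N) := by
  induction q using Quotient.inductionOn with | h r
  refine CuspFormClass.exp_decay_atImInfty (CuspForm.translate f r.val⁻¹) (by positivity) ?_
  rw [inv_inv]
  exact natCast_mem_strictPeriods_conj_Gamma0 N r.2

/-- The `q`-expansion of the `j`-th elementary symmetric polynomial in the translates of `f`
other than `f` itself vanishes below `j / N`. -/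
lemma CuspForm.qExpansion_esymmErase_coeff_eq_zero {N : ℕ} [NeZero N] {k : ℤ}
    (f : CuspForm (Gamma0 N) k) (j : ℕ) {n : ℕ} (hn : n * N < j) :
    coeff n (qExpansion 1 (esymmErase (𝒢 := (Gamma0 N : Subgroup (GL (Fin 2) ℝ))) 𝒮ℒ f j)) = 0 := by
  have hN : 0 < N := NeZero.pos N
  refine qExpansion_coeff_eq_zero_of_isBigO (c := j / N)
    (mod_cast esymmErase_periodic 𝒮ℒ f (one_mem_strictPeriods_Gamma0 N) one_mem_strictPeriods_SL j)
    (esymmErase_mdifferentiable 𝒮ℒ f j) (esymmErase_isBoundedAtImInfty 𝒮ℒ f one_pos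
      (one_mem_strictPeriods_Gamma0 N) one_mem_strictPeriods_SL j) ?_ ?_
  · refine (esymmErase_isBigO 𝒮ℒ f (CuspForm.quotientFunc_isBigO_Gamma0 hN f) j).congr_right ?_
    intro τ
    rw [← Real.exp_nat_mul]
    ring_nf
  · rw [lt_div_iff₀ (by positivity)]
    exact_mod_cast hn

lemma card_quotient_Gamma0 (N : ℕ) :
    Nat.card (𝒮ℒ ⧸ (Gamma0 N : Subgroup (GL (Fin 2) ℝ)).subgroupOf 𝒮ℒ) = (Gamma0 N).index := by
  rw [← Subgroup.index, ← Subgroup.relIndex, MonoidHom.range_eq_map,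
    Subgroup.relIndex_map_map_of_injective, Subgroup.relIndex_top_right]
  exact Matrix.SpecialLinearGroup.mapGL_injective

lemma ValuationSubring.exists_natCast_mem_nonunits (K : Type*) [Field K] [CharZero K] {p : ℕ}
    (hp : p ≠ 1) : ∃ A : ValuationSubring K, (p : K) ∈ A.nonunits := by
  have hI : Ideal.span {(p : (⊥ : Subring K))} ≠ ⊤ := by
    rw [Ne, Ideal.span_singleton_eq_top]
    intro h
    obtain ⟨⟨x, hx⟩, hpx⟩ := h.exists_right_inv
    obtain ⟨n, rfl⟩ := Subring.mem_bot.mp hx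
    have h1 : (p : ℤ) * n = 1 := by
      have := congrArg Subtype.val hpx
      push_cast at this
      exact_mod_cast this
    exact hp (by simpa using Int.isUnit_iff_natAbs_eq.mp (.of_mul_eq_one _ h1))
  obtain ⟨A, -, hA⟩ := Ideal.image_subset_nonunits_valuationSubring _ hI
  exact ⟨A, hA ⟨_, Ideal.mem_span_singleton_self _, by simp⟩⟩

section Valuation

variable {K Γ₀ : Type*} [Field K] [LinearOrderedCommGroupWithZero Γ₀] (v : Valuation K Γ₀)

lemma Valuation.map_intCast_le_one (a : ℤ) : v a ≤ 1 := by
  have h1 (n : ℕ) : v n ≤ 1 := by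
    induction n with
    | zero => simp
    | succ n ih => exact_mod_cast (v.map_add n 1).trans (max_le ih v.map_one.le)
  obtain ⟨n, rfl | rfl⟩ := a.eq_nat_or_neg
  · simpa using h1 n
  · simpa using h1 n

variable {v}

lemma Valuation.map_intCast_lt_one_iff {p : ℕ} (hp : p.Prime) (hv : v p < 1) {a : ℤ} :
    v a < 1 ↔ (p : ℤ) ∣ a := by
  constructor
  · intro ha
    by_contra h
    obtain ⟨x, y, hxy⟩ := ((Nat.prime_iff_prime_int.mp hp).coprime_iff_not_dvd.mpr h)
    have h1 : v ((x : K) * p + y * a) < 1 := by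
      refine v.map_add_lt ?_ ?_
      · rw [map_mul]
        exact (mul_le_of_le_one_left' (v.map_intCast_le_one x)).trans_lt hv
      · rw [map_mul]
        exact (mul_le_of_le_one_left' (v.map_intCast_le_one y)).trans_lt ha
    have h2 : (x : K) * p + y * a = 1 := by exact_mod_cast congrArg (Int.cast (R := K)) hxy
    rw [h2, map_one] at h1
    exact h1.false
  · rintro ⟨b, rfl⟩
    push_cast
    rw [map_mul]
    exact (mul_le_of_le_one_right' (v.map_intCast_le_one b)).trans_lt hv

/-- **Gauss's lemma** for power series with bounded coefficients whose maximal valuations are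
attained. -/
lemma PowerSeries.exists_valuation_coeff_mul_eq {P Q : PowerSeries K} {a b : Γ₀}
    (hP : ∀ n, v (coeff n P) ≤ a) (hQ : ∀ n, v (coeff n Q) ≤ b) (ha : 0 < a) (hb : 0 < b)
    (hPa : ∃ n, v (coeff n P) = a) (hQb : ∃ n, v (coeff n Q) = b) :
    ∃ n, v (coeff n (P * Q)) = a * b := by
  classical
  have hi := Nat.find_spec hPa
  have hj := Nat.find_spec hQb
  set i := Nat.find hPa with hidef
  set j := Nat.find hQb with hjdef
  refine ⟨i + j, ?_⟩
  rw [PowerSeries.coeff_mul, v.map_sum_eq_of_lt (j := (i, j)), map_mul, hi, hj]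
  · simp
  · rintro ⟨i', j'⟩ hij
    simp only [Finset.mem_sdiff, Finset.mem_singleton,
      Finset.HasAntidiagonal.mem_antidiagonal, Prod.mk.injEq] at hij
    rw [map_mul, map_mul, hi, hj]
    rcases lt_or_ge i' i with h | h
    · exact (mul_le_mul_right (hQ _) _).trans_lt
        (mul_lt_mul_of_pos_right ((hP _).lt_of_ne (Nat.find_min hPa h)) hb)
    · exact (mul_le_mul_left (hP _) _).trans_lt (mul_lt_mul_of_pos_left
        ((hQ _).lt_of_ne (Nat.find_min hQb (by lia : j' < j))) ha)

end Valuation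

/-- Suppose that `E (j + 1) = S (j + 1) + F S j`, that `S j` vanishes for `j ≥ m`, and that the
coefficients of each `E j` are controlled by those up to `j / 6`. If some coefficient of `F` is
prime to `p`, then for some `b < m` there are a coefficient of `F` prime to `p` and a nonzero
coefficient of `S b`, in degrees adding up to at most `(b + 1) / 6`. -/
lemma exists_not_dvd_coeff_of_sturm_recursion {K : Type*} [Field K] [CharZero K] {p : ℕ}
    (hp : p.Prime) {m : ℕ} {E S : ℕ → PowerSeries K} {F : PowerSeries ℤ} (hE0 : E 0 = 1)
    (hS0 : S 0 = 1) (hS : ∀ j, S (j + 1) = E (j + 1) - F.map (Int.castRingHom K) * S j)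
    (hSm : ∀ j, m ≤ j → S j = 0)
    (hE : ∀ (I : AddSubgroup K) (j : ℕ), (∀ n ≤ j / 6, coeff n (E j) ∈ I) → ∀ n, coeff n (E j) ∈ I)
    (hF : ∃ n, ¬ (p : ℤ) ∣ coeff n F) :
    ∃ b i t, b + 1 ≤ m ∧ i + t ≤ (b + 1) / 6 ∧ ¬ (p : ℤ) ∣ coeff i F ∧ coeff t (S b) ≠ 0 := by
  classical
  obtain ⟨A, hA⟩ := ValuationSubring.exists_natCast_mem_nonunits K hp.ne_one
  set v := A.valuation
  have hv : v p < 1 := A.mem_nonunits_iff.mp hA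
  obtain ⟨⟨j₀, n₀⟩, -, hmax⟩ := (Finset.range (m + 1) ×ˢ Finset.range (m + 1)).exists_max_image
    (fun x ↦ v (coeff x.2 (E x.1))) ⟨(0, 0), by simp⟩
  simp only [Finset.mem_product, Finset.mem_range, and_imp, Prod.forall] at hmax
  set u := coeff n₀ (E j₀)
  have hu0 : 0 < v u := by
    have := hmax 0 0 (by lia) (by lia)
    simp only [hE0, PowerSeries.coeff_zero_one, map_one] at this
    exact zero_lt_one.trans_le this
  have hFle (n : ℕ) : v (coeff n (F.map (Int.castRingHom K))) ≤ 1 := by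
    simpa using v.map_intCast_le_one _
  have hEle (j : ℕ) (hj : j ≤ m) (n : ℕ) : v (coeff n (E j)) ≤ v u :=
    hE (v.leAddSubgroup (v u)) j (fun n hn ↦ hmax j n (by lia) (by lia)) n
  have hSle (j : ℕ) (hj : j ≤ m) : ∀ n, v (coeff n (S j)) ≤ v u := by
    induction j with
    | zero => simpa [hS0, hE0] using hEle 0 (Nat.zero_le _)
    | succ j ih =>
      intro n
      rw [hS, map_sub, PowerSeries.coeff_mul]
      refine (v.map_sub _ _).trans (max_le (hEle _ hj n) (v.map_sum_le fun x _ ↦ ?_))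
      rw [map_mul]
      exact mul_le_of_le_one_of_le (hFle _) (ih (by lia) _)
  have hex : ∃ b, ∀ i, b ≤ i → ∀ n, v (coeff n (S i)) < v u :=
    ⟨m, fun i hi n ↦ by simpa [hSm i hi] using hu0⟩
  have hbm : Nat.find hex ≤ m := Nat.find_min' hex fun i hi n ↦ by simpa [hSm i hi] using hu0
  have hmulS {j : ℕ} (h : ∀ n, v (coeff n (S j)) < v u) (n : ℕ) :
      v (coeff n (F.map (Int.castRingHom K) * S j)) < v u := by
    rw [PowerSeries.coeff_mul]
    refine v.map_sum_lt' hu0 fun x _ ↦ ?_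
    rw [map_mul]
    exact (mul_le_of_le_one_left' (hFle _)).trans_lt (h _)
  have hspec := Nat.find_spec hex
  have hmin := fun b ↦ Nat.find_min hex (m := b)
  generalize Nat.find hex = b at hbm hspec hmin
  rcases b with _ | b
  · exfalso
    refine lt_irrefl (v u) ?_
    rcases j₀ with _ | j₀
    · simpa [u, hE0, ← hS0] using hspec 0 le_rfl n₀
    · have h := hS j₀
      rw [eq_sub_iff_add_eq] at h
      calc v u = v (coeff n₀ (S (j₀ + 1)) + coeff n₀ (F.map (Int.castRingHom K) * S j₀)) := by
            rw [← map_add, h]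
        _ < v u := v.map_add_lt (hspec _ (Nat.zero_le _) n₀) (hmulS (hspec _ (Nat.zero_le _)) n₀)
  have hSb : ∃ n, v (coeff n (S b)) = v u := by
    have := hmin b (by lia)
    push Not at this
    obtain ⟨i, hi, n, hn⟩ := this
    obtain rfl : b = i := by
      by_contra hne
      exact hn.not_gt (hspec i (by lia) n)
    exact ⟨n, (hSle b (by lia) n).antisymm hn⟩
  have hF1 : ∃ n, v (coeff n (F.map (Int.castRingHom K))) = 1 := by
    obtain ⟨n, hn⟩ := hF
    refine ⟨n, (hFle n).eq_of_not_lt ?_⟩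
    rwa [PowerSeries.coeff_map, eq_intCast, Valuation.map_intCast_lt_one_iff hp hv]
  obtain ⟨n₁, hn₁⟩ := PowerSeries.exists_valuation_coeff_mul_eq hFle (hSle b (by lia)) zero_lt_one
    hu0 hF1 hSb
  have hES (n : ℕ) : coeff n (E (b + 1)) =
      coeff n (S (b + 1)) + coeff n (F.map (Int.castRingHom K) * S b) := by
    rw [hS, map_sub, sub_add_cancel]
  obtain ⟨n, hn, hnE⟩ : ∃ n ≤ (b + 1) / 6, v u ≤ v (coeff n (E (b + 1))) := by
    by_contra! h
    have h1 : v (coeff n₁ (E (b + 1))) < v u :=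
      hE (v.ltAddSubgroup (.mk0 _ hu0.ne')) (b + 1) (fun n hn ↦ h n hn) n₁
    have h2 := (v.map_sub _ _).trans_lt (max_lt h1 (hspec (b + 1) le_rfl n₁))
    rw [hES, add_sub_cancel_left, hn₁, one_mul] at h2
    exact h2.false
  have hnFS : v u ≤ v (coeff n (F.map (Int.castRingHom K) * S b)) := by
    by_contra! h
    refine hnE.not_gt ?_
    rw [hES]
    exact v.map_add_lt (hspec _ le_rfl n) h
  rw [PowerSeries.coeff_mul] at hnFS
  obtain ⟨⟨i, t⟩, hit, hx⟩ : ∃ x ∈ Finset.HasAntidiagonal.antidiagonal n,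
      v u ≤ v (coeff x.1 (F.map (Int.castRingHom K)) * coeff x.2 (S b)) := by
    by_contra! h
    exact hnFS.not_gt (v.map_sum_lt' hu0 h)
  rw [Finset.HasAntidiagonal.mem_antidiagonal] at hit
  dsimp only at hit hx
  refine ⟨b, i, t, hbm, hit.trans_le hn, fun hdvd ↦ ?_, fun h0 ↦ ?_⟩
  · rw [← Valuation.map_intCast_lt_one_iff hp hv] at hdvd
    rw [map_mul, PowerSeries.coeff_map, eq_intCast] at hx
    refine hx.not_gt ?_
    calc _ ≤ v ((coeff i F : ℤ) : K) * v u := by gcongr; exact hSle b (by lia) t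
      _ < 1 * v u := mul_lt_mul_of_pos_right hdvd hu0
      _ = v u := one_mul _
  · rw [h0, mul_zero, map_zero] at hx
    exact hx.not_gt hu0

/-- A coefficient of degree `i` beyond the Sturm bound cannot occur in
`exists_not_dvd_coeff_of_sturm_recursion` when `S b` vanishes below degree `b / N`. -/
lemma sturm_bound_inequality {N m b i t : ℕ} (hN : 0 < N) (hbm : b + 1 ≤ m)
    (hit : i + t ≤ (b + 1) / 6) (hi : 0 < i) (ht : b ≤ t * N)
    (hB : ⌊(m : ℚ) / 6 - ((m : ℚ) - 1) / N⌋ < (i : ℤ)) : False := by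
  rw [Int.floor_lt, sub_lt_iff_lt_add, div_lt_iff₀ (by norm_num)] at hB
  have hN' : (0 : ℚ) < N := by exact_mod_cast hN
  have h1 : (m : ℚ) * N < 6 * i * N + 6 * (m - 1) := by
    have := mul_lt_mul_of_pos_right hB hN'
    field_simp at this
    push_cast at this
    linarith
  have h2 : (m : ℤ) * N < 6 * i * N + 6 * (m - 1) := by exact_mod_cast h1
  have h3 : 6 * (i + t) ≤ b + 1 := by lia
  rcases le_or_gt 6 N with h | h
  · zify at *
    nlinarith
  · interval_cases N <;> lia

/-- Sturm's theorem for one form with an integral `q`-expansion: if `p` divides the coefficients up to the Sturm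
bound, then it divides all of them. -/
lemma CuspForm.dvd_of_dvd_sturm_bound {N : ℕ} [NeZero N] {p : ℕ} (hp : p.Prime)
    (f : CuspForm (Gamma0 N) 2) {a : ℕ → ℤ} (ha0 : a 0 = 0)
    (hf : ∀ τ : ℍ, HasSum
      (fun n : ℕ ↦ (a n : ℂ) * Complex.exp (2 * Real.pi * Complex.I * (τ : ℂ)) ^ n) (f τ))
    (ha : ∀ n : ℕ, (n : ℤ) ≤ ⌊((Gamma0 N).index : ℚ) / 6 - (((Gamma0 N).index : ℚ) - 1) / N⌋ →
      (p : ℤ) ∣ a n) (n : ℕ) : (p : ℤ) ∣ a n := by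
  by_contra hn
  let 𝒢 : Subgroup (GL (Fin 2) ℝ) := Gamma0 N
  have hq : qExpansion 1 f = (PowerSeries.mk a).map (Int.castRingHom ℂ) := by
    ext n
    rw [← ModularFormClass.qExpansion_coeff_unique (c := fun n ↦ (a n : ℂ)) one_pos
      (one_mem_strictPeriods_Gamma0 N)]
    · simp
    · simpa [Function.Periodic.qParam] using hf
  obtain ⟨b, i, t, hbm, hit, hi, ht⟩ := exists_not_dvd_coeff_of_sturm_recursion hp
    (m := (Gamma0 N).index) (F := .mk a)
    (E := fun j ↦ qExpansion 1 (ModularForm.esymm (𝒢 := 𝒢) 𝒮ℒ f j))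
    (S := fun j ↦ qExpansion 1 (esymmErase (𝒢 := 𝒢) 𝒮ℒ f j))
    (by rw [ModularForm.coe_esymm_zero, qExpansion_one])
    (by rw [esymmErase_zero, qExpansion_one])
    (fun j ↦ by
      rw [← hq]
      exact qExpansion_esymmErase_succ 𝒮ℒ f one_pos (one_mem_strictPeriods_Gamma0 N)
        one_mem_strictPeriods_SL j)
    (fun j hj ↦ by
      rw [esymmErase_eq_zero 𝒮ℒ f ((card_quotient_Gamma0 N).trans_le hj), qExpansion_zero])
    (fun I j hj n ↦ by
      refine ModularForm.levelOne_coeff_mem I (k := 2 * j)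
        (ModularForm.mcast (by push_cast; rfl) (ModularForm.esymm (𝒢 := 𝒢) 𝒮ℒ f j)) ?_ n
      intro n hn
      exact hj n (by lia))
    ⟨n, by simpa using hn⟩
  rw [PowerSeries.coeff_mk] at hi
  refine sturm_bound_inequality (NeZero.pos N) hbm hit ?_ ?_ (lt_of_not_ge fun h ↦ hi (ha i h))
  · exact Nat.pos_of_ne_zero fun h ↦ hi (by simp [h, ha0])
  · by_contra! h
    exact ht (f.qExpansion_esymmErase_coeff_eq_zero b h)

end

/-- **Sturm's theorem** for weight-2 cusp forms on `Γ₀(N)` with integer coefficients: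
if the `q`-expansion coefficients of `h` and `g` agree modulo a prime `p` up to the
Sturm bound `B = ⌊ind/6 - (ind - 1)/N⌋` (where `ind = [SL₂(ℤ) : Γ₀(N)]`), then they
agree modulo `p` for all `n`. The `q`-expansions `h(τ) = Σ_{n ≥ 1} aₙ(h) qⁿ` (with
`q = exp(2πiτ)`) are encoded via `HasSum` hypotheses, with the `0`-th coefficient
required to vanish. -/
theorem sturm_theorem_weight_two_Gamma0
    (N : ℕ) (hN : 0 < N) (p : ℕ) (hp : p.Prime)
    (h g : CuspForm (Gamma0 N) 2)
    (ah ag : ℕ → ℤ) (hah0 : ah 0 = 0) (hag0 : ag 0 = 0)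
    (hh : ∀ τ : ℍ, HasSum
      (fun n : ℕ => (ah n : ℂ) * Complex.exp (2 * Real.pi * Complex.I * (τ : ℂ)) ^ n) (h τ))
    (hg : ∀ τ : ℍ, HasSum
      (fun n : ℕ => (ag n : ℂ) * Complex.exp (2 * Real.pi * Complex.I * (τ : ℂ)) ^ n) (g τ))
    (B : ℤ)
    (hB : B = ⌊((Gamma0 N).index : ℚ) / 6 - (((Gamma0 N).index : ℚ) - 1) / N⌋)
    (hcong : ∀ n : ℕ, (n : ℤ) ≤ B → ah n ≡ ag n [ZMOD p]) :
    ∀ n : ℕ, ah n ≡ ag n [ZMOD p] := by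
  have : NeZero N := ⟨hN.ne'⟩
  subst hB
  intro n
  refine (Int.modEq_of_dvd ((h - g).dvd_of_dvd_sturm_bound hp (a := fun n ↦ ah n - ag n)
    (by simp [hah0, hag0]) (fun τ ↦ ?_) (fun n hn ↦ (hcong n hn).symm.dvd) n)).symm
  simpa [sub_mul] using (hh τ).sub (hg τ)
end

section
/- Let N be a positive integer, let B = ⌊ [SL₂(ℤ) : Γ₀(N)]/6 − ([SL₂(ℤ) : Γ₀(N)] − 1)/N ⌋ be the Sturm bound for Γ₀(N), let p be a prime, let f be a cusp form of weight 2 for Γ₀(N) with all q-expansion coefficients in ℤ, and let g₁, …, g_r be cusp forms of weight 2 for Γ₀(N) with all q-expansion coefficients in ℤ. Then the following are equivalent: (1) there exist integers c₁, …, c_r such that aₙ(f) ≡ aₙ(c₁g₁ + ⋯ + c_r g_r) (mod p) for every n ≥ 1; (2) there exist integers c₁, …, c_r such that aₙ(f) ≡ aₙ(c₁g₁ + ⋯ + c_r g_r) (mod p) for every n with 1 ≤ n ≤ B (equivalently, the vector (a₁(f), …, a_B(f)) lies, modulo p, in the ℤ-row span of the vectors (a₁(gᵢ), …, a_B(gᵢ)),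 i = 1, …, r). -/
open UpperHalfPlane Complex CongruenceSubgroup Finset

section IntegralLevelOne

open ModularForm MatrixGroups PowerSeries

/-- The subring of power series over `ℂ` whose coefficients are integers. -/
noncomputable def integralPowerSeries : Subring ℂ⟦X⟧ :=
  (PowerSeries.map (Int.castRingHom ℂ)).range

lemma mem_integralPowerSeries_iff {P : ℂ⟦X⟧} :
    P ∈ integralPowerSeries ↔ ∀ n, ∃ a : ℤ, P.coeff n = a := by
  refine ⟨?_, fun h ↦ ?_⟩
  · rintro ⟨Q, rfl⟩ n
    exact ⟨Q.coeff n, by simp⟩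
  · choose a ha using h
    exact ⟨.mk a, by ext n; simp [ha]⟩

/-- The power series `∑ σₖ(n) qⁿ`. -/
noncomputable def sigmaSeries (k : ℕ) : ℤ⟦X⟧ := .mk fun n ↦ (ArithmeticFunction.sigma k n : ℤ)

lemma qExpansion_E₄ :
    qExpansion 1 E₄ = PowerSeries.map (Int.castRingHom ℂ) (1 + (240 : ℤ) • sigmaSeries 3) := by
  ext n
  rw [EisensteinSeries.E_qExpansion_coeff _ ⟨2, rfl⟩, coeff_map, map_add, map_zsmul]
  rcases eq_or_ne n 0 with rfl | hn
  · simp [sigmaSeries]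
  · simp [hn, sigmaSeries, PowerSeries.coeff_one, show bernoulli 4 = -1 / 30 by decide +kernel]
    norm_num

lemma qExpansion_E₆ :
    qExpansion 1 E₆ = PowerSeries.map (Int.castRingHom ℂ) (1 - (504 : ℤ) • sigmaSeries 5) := by
  ext n
  rw [EisensteinSeries.E_qExpansion_coeff _ ⟨3, rfl⟩, coeff_map, map_sub, map_zsmul]
  rcases eq_or_ne n 0 with rfl | hn
  · simp [sigmaSeries]
  · simp [hn, sigmaSeries, PowerSeries.coeff_one, show bernoulli 6 = 1 / 42 by decide +kernel]
    norm_num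

lemma twelve_dvd_five_mul_sigma_add_seven_mul_sigma (n : ℕ) :
    (12 : ℤ) ∣ 5 * (ArithmeticFunction.sigma 3 n : ℤ) + 7 * ArithmeticFunction.sigma 5 n := by
  simp only [ArithmeticFunction.sigma_apply, Nat.cast_sum, Finset.mul_sum, ← Finset.sum_add_distrib]
  refine Finset.dvd_sum fun d _ ↦ ?_
  push_cast
  have key : ∀ x : ZMod 12, 5 * x ^ 3 + 7 * x ^ 5 = 0 := by decide
  have := key d
  refine (ZMod.intCast_zmod_eq_zero_iff_dvd _ 12).mp ?_
  push_cast
  exact this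

lemma qExpansion_discriminant_eq_smul :
    (1728 : ℂ) • qExpansion 1 CuspForm.discriminant = qExpansion 1 E₄ ^ 3 - qExpansion 1 E₆ ^ 2 := by
  rw [← ModularForm.qExpansion_smul one_pos one_mem_strictPeriods_SL,
    ← ModularForm.qExpansion_pow one_pos one_mem_strictPeriods_SL,
    ← ModularForm.qExpansion_pow one_pos one_mem_strictPeriods_SL,
    ← ModularForm.qExpansion_sub one_pos one_mem_strictPeriods_SL]
  congr 1
  ext z
  simp only [Pi.smul_apply, CuspForm.coe_discriminant, discriminant_eq_E₄_cube_sub_E₆_sq, ModularForm.coe_pow,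
    Pi.sub_apply, Pi.pow_apply, smul_eq_mul]
  ring

lemma qExpansion_discriminant_mem_integralPowerSeries :
    qExpansion 1 CuspForm.discriminant ∈ integralPowerSeries := by
  have hdvd : ∃ R : ℤ⟦X⟧, (5 : ℤ) • sigmaSeries 3 + (7 : ℤ) • sigmaSeries 5 = (12 : ℤ) • R := by
    choose r hr using twelve_dvd_five_mul_sigma_add_seven_mul_sigma
    refine ⟨.mk r, ?_⟩
    ext n
    rw [map_add, map_zsmul, map_zsmul, map_zsmul]
    simpa [sigmaSeries] using hr n
  obtain ⟨R, hR⟩ := hdvd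
  simp only [zsmul_eq_mul, Int.cast_ofNat] at hR
  refine ⟨R + 100 * sigmaSeries 3 ^ 2 + 8000 * sigmaSeries 3 ^ 3 - 147 * sigmaSeries 5 ^ 2, ?_⟩
  have h := qExpansion_discriminant_eq_smul
  rw [qExpansion_E₄, qExpansion_E₆, ← map_pow, ← map_pow, ← map_sub, zsmul_eq_mul, zsmul_eq_mul,
    Int.cast_ofNat, Int.cast_ofNat,
    show (1 + 240 * sigmaSeries 3) ^ 3 - (1 - 504 * sigmaSeries 5) ^ 2 = 1728 *
      (R + 100 * sigmaSeries 3 ^ 2 + 8000 * sigmaSeries 3 ^ 3 - 147 * sigmaSeries 5 ^ 2) by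
      linear_combination 144 * hR, map_mul, map_ofNat] at h
  have h1728 : (1728 : ℂ⟦X⟧) = C (1728 : ℂ) := rfl
  rw [h1728, ← PowerSeries.smul_eq_C_mul] at h
  exact (smul_right_injective _ (by norm_num : (1728 : ℂ) ≠ 0) h).symm

lemma exists_levelOne_form_integral {k : ℕ} (hk : Even k) (hk2 : k ≠ 2) :
    ∃ E : ModularForm 𝒮ℒ k, (qExpansion 1 E).coeff 0 = 1 ∧
      qExpansion 1 E ∈ integralPowerSeries := by
  obtain ⟨a, b, hab⟩ : ∃ a b : ℕ, k = a * 4 + b * 6 := by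
    obtain ⟨j, rfl⟩ := hk
    rcases Nat.even_or_odd j with ⟨i, rfl⟩ | ⟨i, rfl⟩
    · exact ⟨i, 0, by ring⟩
    · exact ⟨i - 1, 1, by lia⟩
  refine ⟨((E₄.pow a).mul (E₆.pow b)).mcast (by lia), ?_⟩
  rw [ModularForm.qExpansion_mcast, ModularForm.qExpansion_mul one_pos one_mem_strictPeriods_SL,
    ModularForm.qExpansion_pow one_pos one_mem_strictPeriods_SL,
    ModularForm.qExpansion_pow one_pos one_mem_strictPeriods_SL]
  have h4 : qExpansion 1 E₄ ∈ integralPowerSeries := ⟨_, qExpansion_E₄.symm⟩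
  have h6 : qExpansion 1 E₆ ∈ integralPowerSeries := ⟨_, qExpansion_E₆.symm⟩
  refine ⟨?_, mul_mem (pow_mem h4 _) (pow_mem h6 _)⟩
  have h4' : constantCoeff (qExpansion 1 E₄) = 1 := by
    rw [← coeff_zero_eq_constantCoeff_apply, EisensteinSeries.E_qExpansion_coeff _ ⟨2, rfl⟩, if_pos rfl]
  have h6' : constantCoeff (qExpansion 1 E₆) = 1 := by
    rw [← coeff_zero_eq_constantCoeff_apply, EisensteinSeries.E_qExpansion_coeff _ ⟨3, rfl⟩, if_pos rfl]
  simp [h4', h6']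

variable (I : AddSubgroup ℂ)

lemma coeff_mul_mem_of_mem_integralPowerSeries {P Q : ℂ⟦X⟧} {m : ℕ} (hP : P ∈ integralPowerSeries)
    (hQ : ∀ n ≤ m, Q.coeff n ∈ I) : (P * Q).coeff m ∈ I := by
  rw [coeff_mul]
  refine sum_mem fun ij hij ↦ ?_
  obtain ⟨a, ha⟩ := mem_integralPowerSeries_iff.mp hP ij.1
  rw [ha, ← zsmul_eq_mul]
  rw [HasAntidiagonal.mem_antidiagonal] at hij
  exact zsmul_mem (hQ _ (by omega)) a

/-- **Sturm bound in level one**, for coefficients in an additive subgroup of `ℂ`. -/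
theorem levelOne_coeff_mem_of_forall_le {k : ℕ} (f : ModularForm 𝒮ℒ k)
    (h : ∀ n ≤ k / 12, (qExpansion 1 f).coeff n ∈ I) (n : ℕ) : (qExpansion 1 f).coeff n ∈ I := by
  induction k using Nat.strong_induction_on generalizing n with | _ k ih =>
  rcases Nat.even_or_odd k with hk | hk
  swap
  · rw [levelOne_odd_weight_eq_zero (mod_cast hk) f]
    simp [qExpansion_zero]
  rcases eq_or_ne k 2 with rfl | hk2
  · rw [rank_zero_iff_forall_zero.mp levelOne_weight_two_rank_zero f]
    simp [qExpansion_zero]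
  obtain ⟨E, hE0, hE⟩ := exists_levelOne_form_integral hk hk2
  set a := (qExpansion 1 f).coeff 0 with ha
  have haI : a ∈ I := h 0 (Nat.zero_le _)
  have haE (n : ℕ) : a * (qExpansion 1 E).coeff n ∈ I := by
    obtain ⟨b, hb⟩ := mem_integralPowerSeries_iff.mp hE n
    rw [hb, mul_comm, ← zsmul_eq_mul]
    exact zsmul_mem haI b
  have hq : qExpansion 1 ⇑(f - a • E) = qExpansion 1 f - a • qExpansion 1 E := by
    rw [FunLike.coe_sub, ModularForm.qExpansion_sub one_pos one_mem_strictPeriods_SL,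
      FunLike.coe_smul, ModularForm.qExpansion_smul one_pos one_mem_strictPeriods_SL]
  have h0 : (qExpansion 1 ⇑(f - a • E)).coeff 0 = 0 := by
    rw [hq, map_sub, coeff_smul, hE0, ← ha, smul_eq_mul, mul_one, sub_self]
  set g := CuspForm.discriminantEquiv (toCuspForm (f - a • E) h0)
  set Δ := qExpansion 1 discriminant
  have hΔ : Δ ∈ integralPowerSeries := qExpansion_discriminant_mem_integralPowerSeries
  have hf : qExpansion 1 f = a • qExpansion 1 E + Δ * qExpansion 1 g := by
    rw [← qExpansion_eq_qExpansion_discriminant_mul, hq]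
    ring
  suffices hg : ∀ n, (qExpansion 1 g).coeff n ∈ I by
    rw [hf, map_add, coeff_smul]
    exact add_mem (haE n) (coeff_mul_mem_of_mem_integralPowerSeries I hΔ fun m _ ↦ hg m)
  rcases lt_or_ge k 12 with hk12 | hk12
  · rw [rank_zero_iff_forall_zero.mp (levelOne_neg_weight_rank_zero (by lia)) g]
    simp [qExpansion_zero]
  have hg' (n : ℕ) (hn : n ≤ (k - 12) / 12) : (qExpansion 1 g).coeff n ∈ I := by
    induction n using Nat.strong_induction_on with | _ n ihn =>
    have hΔ0 : Δ.coeff 0 = 0 := by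
      simpa using CuspFormClass.qExpansion_coeff_zero CuspForm.discriminant one_pos
        one_mem_strictPeriods_SL
    have hΔ1 : Δ.coeff 1 = 1 := discriminant_qExpansion_coeff_one
    obtain ⟨U, hU⟩ : X ∣ Δ := X_dvd_iff.mpr (by simpa using hΔ0)
    have hUΔ (n : ℕ) : U.coeff n = Δ.coeff (n + 1) := by rw [hU, coeff_succ_X_mul]
    have hUint : U ∈ integralPowerSeries := mem_integralPowerSeries_iff.mpr fun n ↦ by
      rw [hUΔ]
      exact mem_integralPowerSeries_iff.mp hΔ _
    have h1 : (U * qExpansion 1 g).coeff n ∈ I := by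
      rw [← coeff_succ_X_mul, ← mul_assoc, ← hU]
      have := congr_arg (coeff (n + 1)) hf
      rw [map_add, coeff_smul, ← sub_eq_iff_eq_add'] at this
      rw [← this]
      exact sub_mem (h _ (by lia)) (haE _)
    rw [coeff_mul, ← Finset.sum_erase_add _ _ (a := (0, n)) (by simp), hUΔ, hΔ1, one_mul] at h1
    refine (add_mem_cancel_left (sum_mem fun ij hij ↦ ?_)).mp h1
    obtain ⟨b, hb⟩ := mem_integralPowerSeries_iff.mp hUint ij.1
    rw [hb, ← zsmul_eq_mul]
    simp only [Finset.mem_erase, HasAntidiagonal.mem_antidiagonal, ne_eq, Prod.ext_iff, not_and] at hij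
    exact zsmul_mem (ihn _ (by omega) (by omega)) b
  have hcast : (k : ℤ) - 12 = ((k - 12 : ℕ) : ℤ) := by lia
  intro n
  simpa using ih (k - 12) (by lia) (g.mcast hcast) (by simpa using hg') n

end IntegralLevelOne

section Newton

/-- If a subalgebra in characteristic zero contains all power sums of a finite family,
then it contains its product. -/
lemma Subalgebra.prod_mem_of_forall_sum_pow_mem {A ι : Type*} [CommRing A] [Algebra ℂ A]
    (S : Subalgebra ℂ A) (s : Finset ι) (x : ι → A) (h : ∀ j ≠ 0, ∑ i ∈ s, x i ^ j ∈ S) :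
    ∏ i ∈ s, x i ∈ S := by
  let φ : MvPolynomial s ℂ →ₐ[ℂ] A := MvPolynomial.aeval fun i ↦ x i
  have hpsum (j : ℕ) (hj : j ≠ 0) : φ (MvPolynomial.psum s ℂ j) ∈ S := by
    simpa [φ, MvPolynomial.psum, Finset.sum_attach s fun i ↦ x i ^ j] using h j hj
  have hesymm (k : ℕ) : φ (MvPolynomial.esymm s ℂ k) ∈ S := by
    induction k using Nat.strong_induction_on with | _ k ih =>
    rcases eq_or_ne k 0 with rfl | hk
    · simp [MvPolynomial.esymm_zero]
    have hnewton := congr_arg φ (MvPolynomial.mul_esymm_eq_sum s ℂ k)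
    have hmem : (k : ℂ) • φ (MvPolynomial.esymm s ℂ k) ∈ S := by
      rw [Algebra.smul_def, map_natCast, ← map_natCast φ, ← map_mul, hnewton, map_mul, map_sum]
      refine mul_mem (by simpa using pow_mem (neg_mem (one_mem S)) _) (sum_mem fun a ha ↦ ?_)
      simp only [Finset.mem_filter, HasAntidiagonal.mem_antidiagonal] at ha
      rw [map_mul, map_mul]
      refine mul_mem (mul_mem ?_ (ih _ ha.2)) (hpsum _ (by omega))
      simpa using pow_mem (neg_mem (one_mem S)) _
    simpa [smul_smul, hk] using S.smul_mem hmem (k : ℂ)⁻¹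
  have hprod := hesymm (Finset.univ : Finset s).card
  rw [MvPolynomial.esymm, Finset.powersetCard_self, Finset.sum_singleton] at hprod
  simpa [φ, Finset.prod_attach s x] using hprod

end Newton

section HasQExpansion

open ModularForm MatrixGroups PowerSeries

/-- `φ` is given on the upper half plane by the power series `P` in `q = exp (2πiτ)`. -/
def HasQExpansion (φ : ℍ → ℂ) (P : ℂ⟦X⟧) : Prop :=
  ∀ τ : ℍ, HasSum (fun n ↦ P.coeff n * Function.Periodic.qParam 1 τ ^ n) (φ τ)

variable {φ ψ : ℍ → ℂ} {P Q : ℂ⟦X⟧}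

lemma HasQExpansion.add (hφ : HasQExpansion φ P) (hψ : HasQExpansion ψ Q) :
    HasQExpansion (φ + ψ) (P + Q) := fun τ ↦ by
  simpa [add_mul] using (hφ τ).add (hψ τ)

lemma HasQExpansion.mul (hφ : HasQExpansion φ P) (hψ : HasQExpansion ψ Q) :
    HasQExpansion (φ * ψ) (P * Q) := fun τ ↦ by
  have h1 := (hφ τ).summable.norm
  have h2 := (hψ τ).summable.norm
  have hsum := (summable_norm_sum_mul_antidiagonal_of_summable_norm h1 h2).of_norm.hasSum
  rw [← tsum_mul_tsum_eq_tsum_sum_antidiagonal_of_summable_norm h1 h2, (hφ τ).tsum_eq,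
    (hψ τ).tsum_eq] at hsum
  refine (congr_arg (HasSum · (φ τ * ψ τ)) (funext fun n ↦ ?_)).mpr hsum
  rw [coeff_mul, Finset.sum_mul]
  refine Finset.sum_congr rfl fun ij hij ↦ ?_
  rw [← HasAntidiagonal.mem_antidiagonal.mp hij, pow_add]
  ring

lemma hasQExpansion_algebraMap (c : ℂ) :
    HasQExpansion (algebraMap ℂ (ℍ → ℂ) c) (C c) := fun τ ↦ by
  simpa using hasSum_single (f := fun n ↦ (C c).coeff n * Function.Periodic.qParam 1 τ ^ n) 0
    fun n hn ↦ by simp [coeff_C, hn]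

lemma hasQExpansion_modularForm {k : ℤ} (f : ModularForm 𝒮ℒ k) :
    HasQExpansion f (qExpansion 1 f) :=
  ModularForm.hasSum_qExpansion f one_pos one_mem_strictPeriods_SL

/-- The functions with a `q`-expansion whose coefficients lie in a finitely generated
`ℤ`-submodule of `ℂ`. -/
noncomputable def fgQExpansion : Subalgebra ℂ (ℍ → ℂ) where
  carrier := {φ | ∃ P, HasQExpansion φ P ∧ ∃ M : Submodule ℤ ℂ, M.FG ∧ ∀ n, P.coeff n ∈ M}
  mul_mem' := by
    rintro φ ψ ⟨P, hP, M, hM, hPM⟩ ⟨Q, hQ, M', hM', hQM⟩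
    refine ⟨P * Q, hP.mul hQ, M * M', hM.mul hM', fun n ↦ ?_⟩
    rw [coeff_mul]
    exact sum_mem fun ij _ ↦ Submodule.mul_mem_mul (hPM _) (hQM _)
  add_mem' := by
    rintro φ ψ ⟨P, hP, M, hM, hPM⟩ ⟨Q, hQ, M', hM', hQM⟩
    refine ⟨P + Q, hP.add hQ, M ⊔ M', hM.sup hM', fun n ↦ ?_⟩
    exact Submodule.add_mem_sup (hPM _) (hQM _)
  algebraMap_mem' c := by
    refine ⟨C c, hasQExpansion_algebraMap c, Submodule.span ℤ {c}, Submodule.fg_span_singleton c,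
      fun n ↦ ?_⟩
    rw [coeff_C]
    split_ifs
    · exact Submodule.mem_span_singleton_self c
    · exact zero_mem _

lemma modularForm_mem_fgQExpansion {k : ℤ} (hk : 0 ≤ k) (f : ModularForm 𝒮ℒ k) :
    ⇑f ∈ fgQExpansion := by
  lift k to ℕ using hk
  let M := Submodule.span ℤ ((fun n ↦ (qExpansion 1 f).coeff n) '' Set.Iic (k / 12))
  refine ⟨_, hasQExpansion_modularForm f, M, Submodule.fg_span ((Set.finite_Iic _).image _), ?_⟩
  exact levelOne_coeff_mem_of_forall_le M.toAddSubgroup f fun n hn ↦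
    Submodule.subset_span ⟨n, hn, rfl⟩

end HasQExpansion

section Decay

open ModularForm MatrixGroups PowerSeries Filter Topology Asymptotics

lemma HasQExpansion.isBoundedAtImInfty {φ : ℍ → ℂ} {P : ℂ⟦X⟧} (h : HasQExpansion φ P) :
    IsBoundedAtImInfty φ :=
  isBoundedAtImInfty_of_hasSum_qExpansion one_pos h

lemma HasQExpansion.of_X_pow_mul {φ : ℍ → ℂ} {P : ℂ⟦X⟧} {n : ℕ} (h : HasQExpansion φ (X ^ n * P)) :
    HasQExpansion (fun τ ↦ φ τ / Function.Periodic.qParam 1 τ ^ n) P := fun τ ↦ by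
  have hq : Function.Periodic.qParam 1 (τ : ℂ) ≠ 0 := Function.Periodic.qParam_ne_zero _
  have := (hasSum_nat_add_iff' n).mpr (h τ)
  rw [Finset.sum_eq_zero fun i hi ↦ by
    rw [coeff_X_pow_mul', if_neg (by simpa using hi), zero_mul], sub_zero] at this
  refine (congr_arg (HasSum · _) (funext fun i ↦ ?_)).mpr
    (this.div_const (Function.Periodic.qParam 1 (τ : ℂ) ^ n))
  rw [coeff_X_pow_mul, pow_add]
  field_simp

lemma HasQExpansion.tendsto_atImInfty {φ : ℍ → ℂ} {P : ℂ⟦X⟧} (h : HasQExpansion φ P) :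
    Tendsto φ atImInfty (𝓝 (P.coeff 0)) := by
  obtain ⟨a, ha⟩ : ∃ a, P.coeff 0 = a := ⟨_, rfl⟩
  obtain ⟨Q, hQ⟩ : X ∣ P - C a := X_dvd_iff.mpr (by simp [← ha])
  rw [ha]
  have h1 : HasQExpansion (φ + algebraMap ℂ (ℍ → ℂ) (-a)) (X ^ 1 * Q) := by
    have hP : P + C (-a) = X ^ 1 * Q := by rw [pow_one, ← hQ, map_neg, sub_eq_add_neg]
    exact hP ▸ h.add (hasQExpansion_algebraMap (-a))
  have h2 : Tendsto (fun τ : ℍ ↦ (φ τ + -a) / Function.Periodic.qParam 1 τ ^ 1 *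
      Function.Periodic.qParam 1 τ) atImInfty (𝓝 0) := by
    have hO : (fun τ : ℍ ↦ (φ τ + -a) / Function.Periodic.qParam 1 τ ^ 1)
      =O[atImInfty] (1 : ℍ → ℝ) := h1.of_X_pow_mul.isBoundedAtImInfty
    exact ((hO.mul (isBigO_refl _ _).norm_right).trans_tendsto (by
      simpa using (qParam_tendsto_atImInfty one_pos).norm))
  have h3 := h2.add_const (a)
  rw [zero_add] at h3
  refine h3.congr fun τ ↦ ?_
  have hq : Function.Periodic.qParam 1 (τ : ℂ) ≠ 0 := Function.Periodic.qParam_ne_zero _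
  field_simp
  ring

/-- A function decaying like `exp (-2πcy)` has vanishing `q`-expansion coefficients below `c`. -/
lemma HasQExpansion.coeff_eq_zero_of_isBigO {φ : ℍ → ℂ} {P : ℂ⟦X⟧} (h : HasQExpansion φ P) {c : ℝ}
    (hc : φ =O[atImInfty] fun τ ↦ Real.exp (-2 * Real.pi * c * τ.im)) {n : ℕ} (hn : n < c) :
    P.coeff n = 0 := by
  induction n using Nat.strong_induction_on with | _ n ih =>
  obtain ⟨Q, rfl⟩ : X ^ n ∣ P := X_pow_dvd_iff.mpr fun m hm ↦
    ih m hm (lt_trans (by exact_mod_cast hm) hn)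
  have h1 := h.of_X_pow_mul.tendsto_atImInfty
  have hO : (fun τ : ℍ ↦ φ τ / Function.Periodic.qParam 1 τ ^ n) =O[atImInfty]
      fun τ ↦ Real.exp (-(2 * Real.pi * (c - n)) * τ.im) := by
    refine (hc.mul (isBigO_refl (fun τ : ℍ ↦ (Function.Periodic.qParam 1 (τ : ℂ) ^ n)⁻¹)
      _).norm_right).congr' (by simp [div_eq_mul_inv]) (.of_forall fun τ ↦ ?_)
    dsimp only
    rw [norm_inv, norm_pow, Function.Periodic.norm_qParam, ← Real.exp_nat_mul, ← Real.exp_neg,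
      ← Real.exp_add]
    congr 1
    simp
    ring
  have h2 : Tendsto (fun τ : ℍ ↦ Real.exp (-(2 * Real.pi * (c - n)) * τ.im)) atImInfty (𝓝 0) := by
    refine Real.tendsto_exp_atBot.comp ?_
    refine (tendsto_comap : Tendsto UpperHalfPlane.im atImInfty atTop).const_mul_atTop_of_neg ?_
    have := Real.pi_pos
    have := sub_pos.mpr hn
    simp only [Left.neg_neg_iff]
    positivity
  rw [coeff_X_pow_mul', if_pos le_rfl, Nat.sub_self]
  exact tendsto_nhds_unique h1 (hO.trans_tendsto h2)

lemma HasQExpansion.unique {φ : ℍ → ℂ} {P Q : ℂ⟦X⟧} (hP : HasQExpansion φ P)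
    (hQ : HasQExpansion φ Q) : P = Q := by
  have h : HasQExpansion 0 (P - Q) := fun τ ↦ by simpa [sub_mul] using (hP τ).sub (hQ τ)
  ext n
  rw [← sub_eq_zero, ← map_sub]
  exact h.coeff_eq_zero_of_isBigO (isBigO_zero _ _) (lt_add_one _)

end Decay

section NormCofactor

open ModularForm MatrixGroups PowerSeries Filter Topology Asymptotics SlashInvariantForm Pointwise

variable {N : ℕ}

/-- The quotient of `SL(2, ℤ)` by `Γ₀(N)`, inside `GL(2, ℝ)`. -/
abbrev Gamma0Quotient (N : ℕ) : Type :=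
  𝒮ℒ ⧸ (Gamma0 N : Subgroup (GL (Fin 2) ℝ)).subgroupOf 𝒮ℒ

lemma natCard_quotient_Gamma0 (N : ℕ) : Nat.card (Gamma0Quotient N) = (Gamma0 N).index := by
  rw [← Subgroup.index, ← Subgroup.relIndex, MonoidHom.range_eq_map,
    Subgroup.relIndex_map_map_of_injective _ _ Matrix.SpecialLinearGroup.mapGL_injective,
    Subgroup.relIndex_top_right]

lemma ModularForm.pow_slash {k : ℤ} {g : GL (Fin 2) ℝ} (hg : g.det = 1) (f : ℍ → ℂ) (n : ℕ) :
    (f ^ n) ∣[(n : ℤ) * k] g = (f ∣[k] g) ^ n := by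
  simpa [hg, -Matrix.GeneralLinearGroup.val_det_apply, mul_comm] using
    prod_slash (k := k) (g := g) (f := fun _ : Fin n ↦ f) (s := Finset.univ)

lemma strictPeriods_conj_Gamma0 (γ : SL(2, ℤ)) : (N : ℝ) ∈
    (ConjAct.toConjAct (γ : GL (Fin 2) ℝ)⁻¹ • (Gamma0 N : Subgroup (GL (Fin 2) ℝ))).strictPeriods := by
  rw [Subgroup.mem_strictPeriods_iff, Subgroup.mem_pointwise_smul_iff_inv_smul_mem]
  refine ⟨γ * ModularGroup.T ^ (N : ℤ) * γ⁻¹, ?_, ?_⟩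
  · exact Gamma0_mem.mpr (Gamma_mem.mp ((Gamma_normal N).conj_mem _
      (by simpa using ModularGroup_T_pow_mem_Gamma N N dvd_rfl) γ)).2.2.1
  · have hT : Matrix.SpecialLinearGroup.mapGL ℝ (ModularGroup.T ^ (N : ℤ)) =
        Matrix.GeneralLinearGroup.upperRightHom (N : ℝ) := by
      ext i j
      rw [Matrix.SpecialLinearGroup.mapGL_coe_matrix, Matrix.SpecialLinearGroup.map_apply_coe,
        RingHom.mapMatrix_apply, ModularGroup.coe_T_zpow]
      fin_cases i <;> fin_cases j <;> simp
    rw [map_mul, map_mul, map_inv, hT, ← ConjAct.toConjAct_inv, inv_inv, ConjAct.toConjAct_smul]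
    rfl

variable [NeZero N]

lemma quotientFunc_isBigO (h : CuspForm (Gamma0 N) 2) (q : Gamma0Quotient N) :
    quotientFunc h q =O[atImInfty] fun τ ↦ Real.exp (-2 * Real.pi * τ.im / N) := by
  induction q using Quotient.inductionOn with | _ r =>
  obtain ⟨r, γ, rfl⟩ := r
  have hN : (0 : ℝ) < N := mod_cast NeZero.pos N
  exact CuspFormClass.exp_decay_atImInfty (CuspForm.translate h (γ : GL (Fin 2) ℝ)⁻¹) hN
    (by simpa using strictPeriods_conj_Gamma0 γ⁻¹)

open scoped Classical in
/-- The product of the nontrivial translates of `h` by `SL(2, ℤ)`. -/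
noncomputable def normCofactor (h : CuspForm (Gamma0 N) 2) : ℍ → ℂ :=
  let := Fintype.ofFinite (Gamma0Quotient N)
  ∏ q ∈ Finset.univ.erase (⟦1⟧ : Gamma0Quotient N), quotientFunc h q

lemma norm_eq_mul_normCofactor (h : CuspForm (Gamma0 N) 2) :
    ⇑(ModularForm.norm 𝒮ℒ (CuspForm.toModularFormₗ h)) = h * normCofactor h := by
  classical
  let := Fintype.ofFinite (Gamma0Quotient N)
  have hprod := Finset.mul_prod_erase Finset.univ (quotientFunc h)
    (Finset.mem_univ (⟦1⟧ : Gamma0Quotient N))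
  rw [quotientFunc_mk, OneMemClass.coe_one, inv_one, SlashAction.slash_one] at hprod
  exact (ModularForm.coe_norm _ _).trans hprod.symm

lemma normCofactor_isBigO (h : CuspForm (Gamma0 N) 2) :
    normCofactor h =O[atImInfty]
      fun τ ↦ Real.exp (-2 * Real.pi * (((Gamma0 N).index - 1) / N) * τ.im) := by
  classical
  let := Fintype.ofFinite (Gamma0Quotient N)
  rw [normCofactor, Finset.prod_fn]
  refine (IsBigO.finsetProd fun q _ ↦ quotientFunc_isBigO h q).congr_right fun τ ↦ ?_
  rw [Finset.prod_const, Finset.card_erase_of_mem (Finset.mem_univ _), Finset.card_univ,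
    ← Nat.card_eq_fintype_card, natCard_quotient_Gamma0, ← Real.exp_nat_mul,
    Nat.cast_sub (Nat.one_le_iff_ne_zero.mpr Subgroup.FiniteIndex.index_ne_zero)]
  congr 1
  push_cast
  ring

lemma normCofactor_mem_fgQExpansion (h : CuspForm (Gamma0 N) 2) (hh : ⇑h ∈ fgQExpansion) :
    normCofactor h ∈ fgQExpansion := by
  classical
  let := Fintype.ofFinite (Gamma0Quotient N)
  rw [normCofactor]
  refine Subalgebra.prod_mem_of_forall_sum_pow_mem _ _ _ fun j _ ↦ ?_
  have htrace := ModularForm.coe_trace 𝒮ℒ ((CuspForm.toModularFormₗ h).pow j)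
  have hpow (q : Gamma0Quotient N) : quotientFunc ((CuspForm.toModularFormₗ h).pow j) q = quotientFunc h q ^ j := by
    induction q using Quotient.inductionOn with | _ r =>
    rw [quotientFunc_mk, quotientFunc_mk, ModularForm.coe_pow]
    obtain ⟨r, γ, rfl⟩ := r
    exact ModularForm.pow_slash (by simp) _ j
  simp only [hpow] at htrace
  have hsum := htrace.trans (Finset.add_sum_erase Finset.univ (fun q ↦ quotientFunc h q ^ j)
    (Finset.mem_univ (⟦1⟧ : Gamma0Quotient N))).symm
  rw [← sub_eq_iff_eq_add'] at hsum
  have hmem : quotientFunc h (⟦1⟧ : Gamma0Quotient N) ∈ fgQExpansion := by simpa using hh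
  have htrace_mem : ⇑(ModularForm.trace 𝒮ℒ ((CuspForm.toModularFormₗ h).pow j)) ∈ fgQExpansion :=
    modularForm_mem_fgQExpansion (by positivity) _
  have hdiff := sub_mem htrace_mem (pow_mem hmem j)
  rw [hsum] at hdiff
  exact hdiff

end NormCofactor

section SturmBound

open ModularForm MatrixGroups PowerSeries

/-- A form of Gauss's lemma for a power series `P` with integer coefficients and a power series `G`
whose coefficients generate a finitely generated group. -/
lemma prime_dvd_of_coeff_mul_mem {p : ℕ} (hp : p.Prime) {a : ℕ → ℤ} {P G : ℂ⟦X⟧}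
    (hP : ∀ n, P.coeff n = a n) (hG : G ≠ 0)
    (hfg : (Submodule.span ℤ (Set.range fun n ↦ G.coeff n)).FG)
    (hPG : ∀ n, (P * G).coeff n ∈
      Ideal.span {(p : ℤ)} • Submodule.span ℤ (Set.range fun n ↦ G.coeff n)) (n : ℕ) :
    (p : ℤ) ∣ a n := by
  classical
  by_contra! hn
  set I := Submodule.span ℤ (Set.range fun n ↦ G.coeff n)
  have hGI (j : ℕ) : G.coeff j ∈ I := Submodule.subset_span ⟨j, rfl⟩
  have hsmul {c : ℤ} (hc : (p : ℤ) ∣ c) (j : ℕ) : c • G.coeff j ∈ Ideal.span {(p : ℤ)} • I :=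
    Submodule.smul_mem_smul (Ideal.mem_span_singleton.mpr hc) (hGI j)
  have hex : ∃ n, ¬ (p : ℤ) ∣ a n := ⟨n, hn⟩
  set m := Nat.find hex
  have hm : ¬ (p : ℤ) ∣ a m := Nat.find_spec hex
  have hlt {i : ℕ} (hi : i < m) : (p : ℤ) ∣ a i := not_not.mp (Nat.find_min hex hi)
  have hmem (j : ℕ) : G.coeff j ∈ Ideal.span {(p : ℤ)} • I := by
    induction j using Nat.strong_induction_on with | _ j ih =>
    have hsum := hPG (m + j)
    rw [coeff_mul, ← Finset.add_sum_erase _ _ (a := (m, j))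
      (HasAntidiagonal.mem_antidiagonal.mpr rfl)] at hsum
    have hmj : a m • G.coeff j ∈ Ideal.span {(p : ℤ)} • I := by
      rw [zsmul_eq_mul, ← hP]
      refine (Submodule.add_mem_iff_left _ (sum_mem fun x hx ↦ ?_)).mp hsum
      rw [Finset.mem_erase, HasAntidiagonal.mem_antidiagonal, ne_eq, Prod.ext_iff] at hx
      rw [hP, ← zsmul_eq_mul]
      rcases lt_or_ge x.1 m with h | h
      · exact hsmul (hlt h) _
      · exact Submodule.smul_mem _ _ (ih _ (by simp only at hx; omega))
    obtain ⟨u, v, huv⟩ := (Nat.prime_iff_prime_int.mp hp).coprime_iff_not_dvd.mpr hm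
    rw [← one_smul ℤ (G.coeff j), ← huv, add_smul, mul_smul v]
    exact add_mem (hsmul (dvd_mul_left _ _) j) (Submodule.smul_mem _ _ hmj)
  obtain ⟨r, hr, hrI⟩ := Submodule.exists_sub_one_mem_and_smul_eq_zero_of_fg_of_le_smul
    (Ideal.span {(p : ℤ)}) I hfg (Submodule.span_le.mpr (Set.range_subset_iff.mpr hmem))
  have hr0 : r ≠ 0 := by
    rintro rfl
    rw [Ideal.mem_span_singleton, zero_sub, dvd_neg] at hr
    exact (Nat.prime_iff_prime_int.mp hp).not_dvd_one hr
  refine hG (ext fun j ↦ ?_)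
  simpa [hr0] using hrI _ (hGI j)

/-- The Sturm bound for cusp forms of weight `2` and level `Γ₀(N)` with integer coefficients. -/
theorem CuspForm.prime_dvd_coeff_of_le_sturm_bound {N : ℕ} [NeZero N] {p : ℕ} (hp : p.Prime)
    (h : CuspForm (Gamma0 N) 2) {P : ℂ⟦X⟧} (hP : HasQExpansion h P) {a : ℕ → ℤ}
    (ha : ∀ n, P.coeff n = a n)
    (hdvd : ∀ n : ℕ, (n : ℤ) ≤ ⌊((Gamma0 N).index : ℚ) / 6 - (((Gamma0 N).index : ℚ) - 1) / N⌋ →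
      (p : ℤ) ∣ a n) (n : ℕ) : (p : ℤ) ∣ a n := by
  rcases eq_or_ne h 0 with rfl | hh
  · have h0 : P = 0 := hP.unique fun τ ↦ by simp
    have han : (a n : ℂ) = 0 := by rw [← ha, h0, map_zero]
    simp [Int.cast_eq_zero.mp han]
  have hfgP : ⇑h ∈ fgQExpansion := by
    refine ⟨P, hP, Submodule.span ℤ {1}, Submodule.fg_span_singleton 1, fun n ↦ ?_⟩
    exact Submodule.mem_span_singleton.mpr ⟨a n, by simp [ha]⟩
  obtain ⟨G, hG, M, hM, hGM⟩ := normCofactor_mem_fgQExpansion h hfgP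
  set F := ModularForm.norm 𝒮ℒ (CuspForm.toModularFormₗ h) with hF
  have hFPG : qExpansion 1 F = P * G := by
    refine (hasQExpansion_modularForm F).unique ?_
    rw [norm_eq_mul_normCofactor]
    exact hP.mul hG
  have hF0 : F ≠ 0 := ModularForm.norm_ne_zero _ fun h0 ↦ hh (DFunLike.coe_injective h0)
  have hG0 : G ≠ 0 := by
    rintro rfl
    rw [mul_zero] at hFPG
    exact hF0 ((ModularForm.qExpansion_eq_zero_iff one_pos one_mem_strictPeriods_SL F).mp hFPG)
  set I := Submodule.span ℤ (Set.range fun n ↦ G.coeff n)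
  have hIM : I ≤ M := Submodule.span_le.mpr (Set.range_subset_iff.mpr hGM)
  have : Module.Finite ℤ M := Module.Finite.iff_fg.mpr hM
  have hI : I.FG := Submodule.FG.of_le hM hIM
  refine prime_dvd_of_coeff_mul_mem hp ha hG0 hI ?_ n
  have hweight : 2 * (Nat.card (Gamma0Quotient N) : ℤ) = ((2 * (Gamma0 N).index : ℕ) : ℤ) := by
    rw [natCard_quotient_Gamma0]
    push_cast
    rfl
  have key := levelOne_coeff_mem_of_forall_le (Ideal.span {(p : ℤ)} • I).toAddSubgroup
    (F.mcast hweight)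
  rw [ModularForm.qExpansion_mcast, hFPG] at key
  refine key fun n hn ↦ ?_
  rw [coeff_mul]
  refine sum_mem fun x hx ↦ ?_
  rw [ha, ← zsmul_eq_mul]
  by_cases hx1 : (x.1 : ℤ) ≤ ⌊((Gamma0 N).index : ℚ) / 6 - (((Gamma0 N).index : ℚ) - 1) / N⌋
  · exact Submodule.smul_mem_smul (Ideal.mem_span_singleton.mpr (hdvd _ hx1))
      (Submodule.subset_span ⟨_, rfl⟩)
  · rw [not_le, Int.floor_lt, Int.cast_natCast] at hx1
    have hx2 : (x.2 : ℚ) < ((Gamma0 N).index - 1) / N := by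
      rw [HasAntidiagonal.mem_antidiagonal] at hx
      have hn6 : ((6 * (x.1 + x.2) : ℕ) : ℚ) ≤ (Gamma0 N).index := by
        exact_mod_cast (by omega : 6 * (x.1 + x.2) ≤ (Gamma0 N).index)
      push_cast at hn6
      linarith
    rw [hG.coeff_eq_zero_of_isBigO (normCofactor_isBigO h) (by exact_mod_cast hx2), smul_zero]
    exact zero_mem _

end SturmBound

/-- Lemma 1 of the paper: a newform `f` with integer coefficients is congruent mod `p` to
a `ℤ`-linear combination of the integral forms `g₁, …, g_r` (at all coefficients `n ≥ 1`)
if and only if it is congruent to such a combination at all coefficients `1 ≤ n ≤ B`,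
where `B = ⌊ind/6 - (ind - 1)/N⌋` is the Sturm bound for `Γ₀(N)`
(with `ind = [SL₂(ℤ) : Γ₀(N)]`); equivalently, iff the vector `(a₁(f), …, a_B(f))` lies
modulo `p` in the `ℤ`-row span of the vectors `(a₁(gᵢ), …, a_B(gᵢ))`. The `q`-expansions
`h(τ) = Σ_{n ≥ 1} aₙ(h) qⁿ` (with `q = exp(2πiτ)`) are encoded via `HasSum` hypotheses;
since `aₙ` is `ℤ`-linear in the form, the `n`-th coefficient of `c₁g₁ + ⋯ + c_r g_r`
is `Σᵢ cᵢ aₙ(gᵢ)`. -/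
theorem congruent_to_old_space_iff_congruent_up_to_sturm_bound
    (N : ℕ) (hN : 0 < N) (p : ℕ) (hp : p.Prime) (r : ℕ)
    (f : CuspForm (Gamma0 N) 2) (g : Fin r → CuspForm (Gamma0 N) 2)
    (af : ℕ → ℤ) (ag : Fin r → ℕ → ℤ)
    (haf0 : af 0 = 0) (hag0 : ∀ i, ag i 0 = 0)
    (hf : ∀ τ : ℍ, HasSum
      (fun n : ℕ => (af n : ℂ) * Complex.exp (2 * Real.pi * Complex.I * (τ : ℂ)) ^ n) (f τ))
    (hg : ∀ i, ∀ τ : ℍ, HasSum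
      (fun n : ℕ => (ag i n : ℂ) * Complex.exp (2 * Real.pi * Complex.I * (τ : ℂ)) ^ n)
      ((g i) τ))
    (B : ℤ)
    (hB : B = ⌊((Gamma0 N).index : ℚ) / 6 - (((Gamma0 N).index : ℚ) - 1) / N⌋) :
    (∃ c : Fin r → ℤ, ∀ n : ℕ, 1 ≤ n →
        af n ≡ ∑ i, c i * ag i n [ZMOD p]) ↔
    (∃ c : Fin r → ℤ, ∀ n : ℕ, 1 ≤ n → (n : ℤ) ≤ B →
        af n ≡ ∑ i, c i * ag i n [ZMOD p]) := by
  refine ⟨fun ⟨c, hc⟩ ↦ ⟨c, fun n hn _ ↦ hc n hn⟩, fun ⟨c, hc⟩ ↦ ⟨c, fun n _ ↦ ?_⟩⟩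
  have : NeZero N := ⟨hN.ne'⟩
  let a : ℕ → ℤ := fun n ↦ ∑ i, c i * ag i n - af n
  let h : CuspForm (Gamma0 N) 2 := ∑ i, (c i : ℂ) • g i - f
  have hP : HasQExpansion h (.mk fun n ↦ (a n : ℂ)) := fun τ ↦ by
    have hsum := (hasSum_sum fun i (_ : i ∈ Finset.univ) ↦ (hg i τ).mul_left (c i : ℂ)).sub (hf τ)
    have hval : h τ = ∑ i, (c i : ℂ) * g i τ - f τ := by simp [h]
    rw [hval]
    refine (congr_arg (HasSum · _) (funext fun n ↦ ?_)).mpr hsum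
    simp [a, Function.Periodic.qParam, sub_mul, Finset.sum_mul, mul_assoc]
  refine Int.modEq_iff_dvd.mpr (h.prime_dvd_coeff_of_le_sturm_bound hp hP (a := a) (by simp)
    (fun n hn ↦ ?_) n)
  rcases Nat.eq_zero_or_pos n with rfl | hn0
  · simp [a, haf0, hag0]
  · exact (hc n hn0 (hB ▸ hn)).dvd
end

section
/- Let N be a positive integer, p a prime, f a cusp form of weight 2 for Γ₀(N) with all q-expansion coefficients in ℤ, and g₁, …, g_r cusp forms of weight 2 for Γ₀(N) with all q-expansion coefficients in ℤ. If there exist integers c₁, …, c_r such that aₙ(f) ≡ aₙ(c₁g₁ + ⋯ + c_r g_r) (mod p) for every n with 1 ≤ n ≤ B, where B = ⌊ [SL₂(ℤ) : Γ₀(N)]/6 − ([SL₂(ℤ) : Γ₀(N)] − 1)/N ⌋ is the Sturm bound for Γ₀(N), then aₙ(f) ≡ aₙ(c₁g₁ + ⋯ + c_r g_r) (mod p) for every n ≥ 1; in particular f is congruent modulo p to a form in the ℤ-span of g₁, …, g_r. -/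
open UpperHalfPlane Complex CongruenceSubgroup Finset

section

open scoped MatrixGroups ModularForm Manifold Topology PowerSeries
open Filter Asymptotics

/-- `F` is the sum of the power series `φ` evaluated at `q = exp (2πiτ)`. -/
def HasQSeries (φ : ℂ⟦X⟧) (F : ℍ → ℂ) : Prop :=
  ∀ τ : ℍ, HasSum (fun n : ℕ => φ.coeff n * Function.Periodic.qParam 1 τ ^ n) (F τ)

namespace HasQSeries

local notation "𝕢" => Function.Periodic.qParam

variable {φ ψ : ℂ⟦X⟧} {F G : ℍ → ℂ}

lemma add (hF : HasQSeries φ F) (hG : HasQSeries ψ G) :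
    HasQSeries (φ + ψ) (fun τ => F τ + G τ) := fun τ => by
  simpa [add_mul] using (hF τ).add (hG τ)

lemma const_mul (c : ℂ) (hF : HasQSeries φ F) :
    HasQSeries (PowerSeries.C c * φ) (fun τ => c * F τ) := fun τ => by
  simpa [mul_assoc] using (hF τ).mul_left c

lemma zero : HasQSeries 0 (fun _ => 0) := fun τ => by simp [hasSum_zero]

lemma one : HasQSeries 1 (fun _ => 1) := fun τ => by
  convert hasSum_single (f := fun n : ℕ => (1 : ℂ⟦X⟧).coeff n * 𝕢 1 (τ : ℂ) ^ n) 0 ?_ using 1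
  · simp
  · intro n hn
    simp [PowerSeries.coeff_one, hn]

lemma sum {ι : Type*} (s : Finset ι) {φ : ι → ℂ⟦X⟧} {F : ι → ℍ → ℂ}
    (h : ∀ i ∈ s, HasQSeries (φ i) (F i)) :
    HasQSeries (∑ i ∈ s, φ i) (fun τ => ∑ i ∈ s, F i τ) := fun τ => by
  simpa [Finset.sum_mul] using hasSum_sum (fun i hi => h i hi τ)

lemma mul (hF : HasQSeries φ F) (hG : HasQSeries ψ G) :
    HasQSeries (φ * ψ) (fun τ => F τ * G τ) := fun τ => by
  have hf := (hF τ).summable.norm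
  have hg := (hG τ).summable.norm
  have h := (summable_norm_sum_mul_antidiagonal_of_summable_norm hf hg).of_norm.hasSum
  rw [← tsum_mul_tsum_eq_tsum_sum_antidiagonal_of_summable_norm hf hg, (hF τ).tsum_eq,
    (hG τ).tsum_eq] at h
  refine h.congr_fun fun n => ?_
  rw [PowerSeries.coeff_mul, Finset.sum_mul]
  refine Finset.sum_congr rfl fun x hx => ?_
  rw [← (Finset.HasAntidiagonal.mem_antidiagonal.mp hx)]
  ring

lemma pow (hF : HasQSeries φ F) (n : ℕ) : HasQSeries (φ ^ n) (fun τ => F τ ^ n) := by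
  induction n with
  | zero => simpa using one
  | succ n ih => simpa [pow_succ] using ih.mul hF

lemma tendsto_div_qParam_pow (hF : HasQSeries φ F) {M : ℕ} (hM : ∀ n < M, φ.coeff n = 0) :
    Tendsto (fun τ : ℍ => F τ / 𝕢 1 τ ^ M) atImInfty (𝓝 (φ.coeff M)) := by
  have hq0 (τ : ℍ) : 𝕢 1 (τ : ℂ) ≠ 0 := Complex.exp_ne_zero _
  have hs (τ : ℍ) : HasSum (fun n : ℕ => φ.coeff (n + M) * 𝕢 1 (τ : ℂ) ^ n)
      (F τ / 𝕢 1 τ ^ M) := by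
    have h := (hasSum_nat_add_iff' M).mpr (hF τ)
    rw [Finset.sum_eq_zero fun n hn => by rw [hM n (Finset.mem_range.mp hn), zero_mul],
      sub_zero] at h
    refine (h.div_const (𝕢 1 (τ : ℂ) ^ M)).congr_fun fun n => ?_
    have := hq0 τ
    rw [pow_add]
    field_simp
  have hq : Tendsto (fun τ : ℍ => 𝕢 1 (τ : ℂ)) atImInfty (𝓝 0) :=
    qParam_tendsto_atImInfty one_pos
  have key : Tendsto (fun τ : ℍ => ∑' n : ℕ, φ.coeff (n + M) * 𝕢 1 (τ : ℂ) ^ n) atImInfty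
      (𝓝 (∑' n : ℕ, φ.coeff (n + M) * 0 ^ n)) := by
    refine tendsto_tsum_of_dominated_convergence (hs UpperHalfPlane.I).summable.norm (fun n => ?_) ?_
    · exact (hq.pow n).const_mul _
    · have : ∀ᶠ τ : ℍ in atImInfty, ‖𝕢 1 (τ : ℂ)‖ < ‖𝕢 1 (UpperHalfPlane.I : ℂ)‖ :=
        hq.norm.eventually_lt_const (by simpa using hq0 UpperHalfPlane.I)
      filter_upwards [this] with τ hτ n
      rw [norm_mul, norm_mul, norm_pow, norm_pow]
      gcongr
  rw [tsum_eq_single 0 fun n hn => by simp [hn]] at key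
  simpa [(hs _).tsum_eq] using key

lemma isBigO (hF : HasQSeries φ F) {M : ℕ} (hM : ∀ n < M, φ.coeff n = 0) :
    F =O[atImInfty] fun τ : ℍ => Real.exp (-2 * Real.pi * M * τ.im) := by
  have h := (hF.tendsto_div_qParam_pow hM).isBigO_one ℝ
  have h2 := h.mul (isBigO_refl (fun τ : ℍ => 𝕢 1 (τ : ℂ) ^ M) atImInfty).norm_right
  refine (h2.congr' ?_ ?_)
  · filter_upwards with τ
    exact div_mul_cancel₀ _ (pow_ne_zero _ (Complex.exp_ne_zero _))
  · filter_upwards with τ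
    rw [one_mul, norm_pow, Function.Periodic.norm_qParam, ← Real.exp_nat_mul]
    congr 1
    simp
    ring

lemma coeff_eq_zero (hF : HasQSeries φ F) {T : ℝ}
    (hO : F =O[atImInfty] fun τ : ℍ => Real.exp (-2 * Real.pi * T * τ.im)) (n : ℕ)
    (hn : (n : ℝ) < T) : φ.coeff n = 0 := by
  induction n using Nat.strong_induction_on with
  | _ n ih =>
    have h := hF.tendsto_div_qParam_pow fun j hj =>
      ih j hj (lt_trans (by exact_mod_cast hj) hn)
    refine tendsto_nhds_unique h ?_
    have h2 := hO.mul (isBigO_refl (fun τ : ℍ => (𝕢 1 (τ : ℂ) ^ n)⁻¹) atImInfty).norm_right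
    simp_rw [← div_eq_mul_inv] at h2
    refine h2.trans_tendsto ?_
    have h3 : Tendsto (fun τ : ℍ => Real.exp (-(2 * Real.pi * (T - n) * τ.im))) atImInfty
        (𝓝 0) := by
      refine (Real.tendsto_exp_neg_atTop_nhds_zero).comp ?_
      exact (tendsto_comap (f := UpperHalfPlane.im)).const_mul_atTop (by
        have := Real.pi_pos
        have : 0 < T - n := by linarith
        positivity)
    refine h3.congr fun τ => ?_
    rw [norm_inv, norm_pow, Function.Periodic.norm_qParam, ← Real.exp_nat_mul, ← Real.exp_neg,
      ← Real.exp_add]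
    congr 1
    simp
    ring

end HasQSeries

lemma ModularForm.hasQSeries {k : ℤ} (f : ModularForm 𝒮ℒ k) : HasQSeries (qExpansion 1 f) f :=
  fun τ => by simpa using ModularForm.hasSum_qExpansion (f := f) one_pos one_mem_strictPeriods_SL τ

lemma ModularForm.levelOne_eq_zero_of_isBigO {k : ℤ} (hk : 0 ≤ k) (f : ModularForm 𝒮ℒ k) {T : ℝ}
    (hO : f =O[atImInfty] fun τ : ℍ => Real.exp (-2 * Real.pi * T * τ.im)) (hT : k < 12 * T) :
    f = 0 := by
  apply ModularForm.sturm_bound_levelOne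
  lift k to ℕ using hk
  have := f.hasQSeries
  refine lt_of_lt_of_le (b := ((k / 12 + 1 : ℕ) : ℕ∞)) (by simpa using ENat.natCast_lt_succ) ?_
  refine PowerSeries.nat_le_order _ _ fun i hi => this.coeff_eq_zero hO i ?_
  have h : 12 * i ≤ k := by omega
  have : (12 * i : ℝ) ≤ k := by exact_mod_cast h
  push_cast at hT
  linarith

/-- A function on the upper half-plane which is holomorphic, invariant under the weight `k`
action of `Γ₀(N)` and bounded at all cusps, as a modular form. -/
noncomputable def ModularForm.ofGamma0 {N : ℕ} [NeZero N] {k : ℤ} {F : ℍ → ℂ} (hF : MDiff F)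
    (hinv : ∀ γ ∈ Gamma0 N, F ∣[k] γ = F)
    (hbdd : ∀ γ : SL(2, ℤ), IsBoundedAtImInfty (F ∣[k] γ)) : ModularForm (Gamma0 N) k where
  toFun := F
  slash_action_eq' γ hγ := by
    obtain ⟨γ, hγ, rfl⟩ := hγ
    exact hinv γ hγ
  holo' := hF
  bdd_at_cusps' {c} hc := by
    rw [Subgroup.IsArithmetic.isCusp_iff_isCusp_SL2Z] at hc
    exact (OnePoint.isBoundedAt_iff_forall_SL2Z hc).mpr fun γ _ => hbdd γ

lemma natCard_quotient_gamma0 (N : ℕ) :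
    Nat.card (𝒮ℒ ⧸ ((Gamma0 N : Subgroup (GL (Fin 2) ℝ)).subgroupOf 𝒮ℒ)) = (Gamma0 N).index := by
  change Subgroup.relIndex _ _ = _
  rw [MonoidHom.range_eq_map, Subgroup.relIndex_map_map_of_injective]
  · simp
  · exact Matrix.SpecialLinearGroup.mapGL_injective

lemma isBoundedAtImInfty_of_isBigO {F : ℍ → ℂ} {t : ℝ} (ht : 0 ≤ t)
    (h : F =O[atImInfty] fun τ : ℍ => Real.exp (-2 * Real.pi * t * τ.im)) :
    IsBoundedAtImInfty F := by
  refine h.trans (.of_bound 1 (.of_forall fun τ => ?_))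
  have := Real.pi_pos
  have := τ.im_pos
  have : 0 ≤ 2 * Real.pi * t * τ.im := by positivity
  simp
  linarith

lemma eq_zero_of_isBigO_gamma0 {N : ℕ} [NeZero N] {k : ℤ} (hk : 0 ≤ k) {F : ℍ → ℂ} (hF : MDiff F)
    (hinv : ∀ γ ∈ Gamma0 N, F ∣[k] γ = F) {t₀ t : ℝ} (ht₀ : 0 ≤ t₀) (ht : 0 ≤ t)
    (h₀ : F =O[atImInfty] fun τ : ℍ => Real.exp (-2 * Real.pi * t₀ * τ.im))
    (h : ∀ γ ∉ Gamma0 N,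
      (F ∣[k] γ) =O[atImInfty] fun τ : ℍ => Real.exp (-2 * Real.pi * t * τ.im))
    (hlt : k * (Gamma0 N).index < 12 * (t₀ + ((Gamma0 N).index - 1) * t)) : F = 0 := by
  have hbdd (γ : SL(2, ℤ)) : IsBoundedAtImInfty (F ∣[k] γ) := by
    by_cases hγ : γ ∈ Gamma0 N
    · rw [hinv γ hγ]
      exact isBoundedAtImInfty_of_isBigO ht₀ h₀
    · exact isBoundedAtImInfty_of_isBigO ht (h γ hγ)
  set f := ModularForm.ofGamma0 hF hinv hbdd
  suffices ModularForm.norm 𝒮ℒ f = 0 from (ModularForm.norm_eq_zero_iff _ f).mp this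
  have hcard := natCard_quotient_gamma0 N
  classical
  let := Fintype.ofFinite (𝒮ℒ ⧸ ((Gamma0 N : Subgroup (GL (Fin 2) ℝ)).subgroupOf 𝒮ℒ))
  let e : 𝒮ℒ ⧸ ((Gamma0 N : Subgroup (GL (Fin 2) ℝ)).subgroupOf 𝒮ℒ) := ((1 : 𝒮ℒ) : _ ⧸ _)
  refine ModularForm.levelOne_eq_zero_of_isBigO (T := ∑ q, if q = e then t₀ else t)
    (by positivity) _ ?_ ?_
  · rw [ModularForm.coe_norm]
    have hexp : (fun τ : ℍ => Real.exp (-2 * Real.pi * (∑ q, if q = e then t₀ else t) * τ.im)) =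
        fun τ : ℍ => ∏ q, Real.exp (-2 * Real.pi * (if q = e then t₀ else t) * τ.im) := by
      ext τ
      rw [← Real.exp_sum, Finset.mul_sum, Finset.sum_mul]
    rw [hexp, Finset.prod_fn]
    refine .finsetProd fun q _ => ?_
    induction q using Quotient.inductionOn with | h γ =>
    rw [SlashInvariantForm.quotientFunc_mk]
    obtain ⟨_, γ, rfl⟩ := γ
    have hmem : ((⟦⟨Matrix.SpecialLinearGroup.mapGL ℝ γ, γ, rfl⟩⟧ : 𝒮ℒ ⧸ _) = e) ↔
        γ ∈ Gamma0 N := by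
      refine QuotientGroup.eq.trans ?_
      rw [Subgroup.mem_subgroupOf, mul_one, Subgroup.coe_inv, inv_mem_iff]
      exact Subgroup.mem_map_iff_mem Matrix.SpecialLinearGroup.mapGL_injective
    have hslash : (F ∣[k] (Matrix.SpecialLinearGroup.mapGL ℝ γ)⁻¹) = F ∣[k] γ⁻¹ := by
      rw [ModularForm.SL_slash, map_inv]
      rfl
    change (F ∣[k] (Matrix.SpecialLinearGroup.mapGL ℝ γ)⁻¹) =O[atImInfty] _
    rw [hslash]
    by_cases hγ : γ ∈ Gamma0 N
    · rwa [if_pos (hmem.mpr hγ), hinv _ (inv_mem hγ)]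
    · rw [if_neg (mt hmem.mp hγ)]
      exact h _ (by rwa [inv_mem_iff])
  · have hite (q) : (if q = e then t₀ else t) = t + if q = e then t₀ - t else 0 := by
      split_ifs <;> ring
    simp_rw [hite]
    rw [Finset.sum_add_distrib, Finset.sum_ite_eq' univ e, if_pos (Finset.mem_univ e),
      Finset.sum_const, Finset.card_univ, ← Nat.card_eq_fintype_card, hcard, nsmul_eq_mul]
    push_cast
    linarith

lemma CuspForm.slash_eq_of_mem_gamma0 {N : ℕ} {k : ℤ} (f : CuspForm (Gamma0 N) k)
    {γ : SL(2, ℤ)} (hγ : γ ∈ Gamma0 N) : (f : ℍ → ℂ) ∣[k] γ = f :=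
  SlashInvariantForm.slash_action_eqn f _ ⟨γ, hγ, rfl⟩

lemma Gamma_le_Gamma0 (N : ℕ) : CongruenceSubgroup.Gamma N ≤ Gamma0 N := fun γ hγ => by
  rw [Gamma0_mem]
  exact (Gamma_mem.mp hγ).2.2.1

lemma CuspForm.isBigO_atImInfty_gamma0 {N : ℕ} [NeZero N] {k : ℤ} (f : CuspForm (Gamma0 N) k) :
    f =O[atImInfty] fun τ : ℍ => Real.exp (-2 * Real.pi * τ.im) := by
  simpa using CuspFormClass.exp_decay_atImInfty f (h := 1) one_pos (by simp)

lemma CuspForm.slash_isBigO_atImInfty_gamma0 {N : ℕ} [NeZero N] {k : ℤ}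
    (f : CuspForm (Gamma0 N) k) (γ : SL(2, ℤ)) :
    (f ∣[k] γ) =O[atImInfty] fun τ : ℍ => Real.exp (-2 * Real.pi * (1 / N) * τ.im) := by
  have hz : IsZeroAtImInfty (f ∣[k] γ) := by
    have hc : IsCusp (Matrix.SpecialLinearGroup.mapGL ℝ γ • OnePoint.infty) 𝒮ℒ :=
      isCusp_SL2Z_iff'.mpr ⟨γ, rfl⟩
    refine (OnePoint.isZeroAt_iff_forall_SL2Z hc).mp ?_ γ rfl
    exact CuspFormClass.zero_at_cusps f (Subgroup.IsArithmetic.isCusp_iff_isCusp_SL2Z _ |>.mpr hc)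
  have hT : ((f : ℍ → ℂ) ∣[k] γ) ∣[k] (ModularGroup.T ^ (N : ℤ)) = (f : ℍ → ℂ) ∣[k] γ := by
    rw [← SlashAction.slash_mul,
      show γ * ModularGroup.T ^ (N : ℤ) = (γ * ModularGroup.T ^ (N : ℤ) * γ⁻¹) * γ by group,
      SlashAction.slash_mul]
    congr 1
    refine f.slash_eq_of_mem_gamma0 (Gamma_le_Gamma0 N ?_)
    exact (Gamma_normal N).conj_mem _ (ModularGroup_T_pow_mem_Gamma N N dvd_rfl) γ
  have hper : Function.Periodic (((f : ℍ → ℂ) ∣[k] γ) ∘ ofComplex) ((N : ℝ) : ℂ) := by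
    intro w
    simp only [Function.comp_apply]
    by_cases hw : 0 < w.im
    · have hw' : 0 < (w + ((N : ℝ) : ℂ)).im := by simpa
      rw [ofComplex_apply_of_im_pos hw, ofComplex_apply_of_im_pos hw']
      have h1 : (ModularGroup.T ^ (N : ℤ)) • (⟨w, hw⟩ : ℍ) = ⟨w + ((N : ℝ) : ℂ), hw'⟩ := by
        ext1
        simpa using ModularGroup.coe_T_zpow_smul_eq (n := (N : ℤ)) (z := (⟨w, hw⟩ : ℍ))
      have h2 := congrFun hT ⟨w, hw⟩
      rw [ModularForm.SL_slash_apply (f ∣[k] γ : ℍ → ℂ), h1] at h2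
      rw [ModularGroup.denom_apply, ModularGroup.coe_T_zpow] at h2
      simpa using h2
    · have hw' : (w + ((N : ℝ) : ℂ)).im ≤ 0 := by simpa using hw
      rw [ofComplex_apply_of_im_nonpos (not_lt.mp hw), ofComplex_apply_of_im_nonpos hw']
  have h := hz.exp_decay_atImInfty (h := (N : ℝ)) (by exact_mod_cast NeZero.pos N) hper
    ((CuspFormClass.holo f).slash k γ) hz.isBoundedAtImInfty
  refine h.congr_right fun τ => ?_
  congr 1
  ring

/-- `G` is the weight `k` translate of `F` by `γ`. -/
def IsTranslate (γ : SL(2, ℤ)) (k : ℕ) (F G : ℍ → ℂ) : Prop :=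
  ∀ τ : ℍ, F (γ • τ) = denom γ τ ^ k * G τ

namespace IsTranslate

variable {γ : SL(2, ℤ)} {k l : ℕ} {F F' G G' : ℍ → ℂ}

lemma slash (F : ℍ → ℂ) : IsTranslate γ k F (F ∣[(k : ℤ)] γ) := fun τ => by
  rw [ModularForm.SL_slash_apply, zpow_neg, zpow_natCast, mul_comm,
    inv_mul_cancel_right₀ (pow_ne_zero _ (denom_ne_zero _ τ))]

lemma slash_eq (h : IsTranslate γ k F G) : F ∣[(k : ℤ)] γ = G := by
  ext τ
  rw [ModularForm.SL_slash_apply, h τ, zpow_neg, zpow_natCast, mul_comm,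
    inv_mul_cancel_left₀ (pow_ne_zero _ (denom_ne_zero _ τ))]

lemma mul (h : IsTranslate γ k F G) (h' : IsTranslate γ l F' G') :
    IsTranslate γ (k + l) (fun τ => F τ * F' τ) (fun τ => G τ * G' τ) := fun τ => by
  simp only [h τ, h' τ]
  ring

lemma pow (h : IsTranslate γ k F G) (n : ℕ) :
    IsTranslate γ (k * n) (fun τ => F τ ^ n) (fun τ => G τ ^ n) := fun τ => by
  simp only [h τ]
  ring

lemma div (h : IsTranslate γ (k + l) F G) (h' : IsTranslate γ l F' G') :
    IsTranslate γ k (fun τ => F τ / F' τ) (fun τ => G τ / G' τ) := fun τ => by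
  simp only [h τ, h' τ]
  rw [pow_add, mul_assoc, mul_left_comm,
    mul_div_mul_left _ _ (pow_ne_zero _ (denom_ne_zero _ τ)), mul_div_assoc]

lemma const_mul (c : ℂ) (h : IsTranslate γ k F G) :
    IsTranslate γ k (fun τ => c * F τ) (fun τ => c * G τ) := fun τ => by
  simp only [h τ]
  ring

lemma sum {ι : Type*} (s : Finset ι) {F G : ι → ℍ → ℂ} (h : ∀ i ∈ s, IsTranslate γ k (F i) (G i)) :
    IsTranslate γ k (fun τ => ∑ i ∈ s, F i τ) (fun τ => ∑ i ∈ s, G i τ) := fun τ => by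
  rw [Finset.mul_sum]
  exact Finset.sum_congr rfl fun i hi => h i hi τ

end IsTranslate

lemma isTranslate_of_levelOne {k : ℕ} {F : Type*} [FunLike F ℍ ℂ]
    [SlashInvariantFormClass F 𝒮ℒ k] (f : F) (γ : SL(2, ℤ)) :
    IsTranslate γ k f f := by
  have h := IsTranslate.slash (γ := γ) (k := k) f
  rwa [show (f : ℍ → ℂ) ∣[(k : ℤ)] γ = f from
    SlashInvariantFormClass.slash_action_eq f _ ⟨γ, rfl⟩] at h

lemma isTranslate_discriminant (γ : SL(2, ℤ)) :
    IsTranslate γ 12 ModularForm.discriminant ModularForm.discriminant :=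
  isTranslate_of_levelOne (k := 12) CuspForm.discriminant γ

/-- Multiplication by a positive integer on the upper half-plane. -/
noncomputable def UpperHalfPlane.natMul (N : ℕ) [NeZero N] (τ : ℍ) : ℍ :=
  ⟨N * τ, by simpa using mul_pos (Nat.cast_pos.mpr (NeZero.pos N)) τ.im_pos⟩

@[simp]
lemma UpperHalfPlane.coe_natMul (N : ℕ) [NeZero N] (τ : ℍ) : (natMul N τ : ℂ) = N * τ := rfl

@[simp]
lemma UpperHalfPlane.im_natMul (N : ℕ) [NeZero N] (τ : ℍ) : (natMul N τ).im = N * τ.im := by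
  rw [← coe_im, coe_natMul]
  simp

lemma discriminant_of_coe_eq_add_int {z w : ℍ} (b : ℤ) (h : (w : ℂ) = z + b) :
    ModularForm.discriminant w = ModularForm.discriminant z := by
  have h1 : ModularGroup.T ^ b • z = w := by
    ext1
    rw [h, ModularGroup.coe_T_zpow_smul_eq]
  have h2 := isTranslate_discriminant (ModularGroup.T ^ b) z
  rw [h1, ModularGroup.denom_apply, ModularGroup.coe_T_zpow] at h2
  simpa using h2

lemma discriminant_natMul_smul {N : ℕ} [NeZero N] (γ : SL(2, ℤ)) :
    ∃ (t g : ℕ) (b : ℤ), 0 < t ∧ t * g = N ∧ (γ ∈ Gamma0 N ↔ t = 1) ∧ ∀ τ w : ℍ,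
      (w : ℂ) = (g * τ + b) / t → ModularForm.discriminant (natMul N (γ • τ)) =
        denom γ τ ^ 12 * (ModularForm.discriminant w / t ^ 12) := by
  obtain ⟨g, hg⟩ : ∃ g, g = Int.gcd N (γ 1 0) := ⟨_, rfl⟩
  have hN := NeZero.pos N
  have hg0 : 0 < g := hg ▸ Int.gcd_pos_of_ne_zero_left _ (by exact_mod_cast hN.ne')
  obtain ⟨t, ht⟩ : (g : ℤ) ∣ N := hg ▸ Int.gcd_dvd_left ..
  obtain ⟨c, hc⟩ : (g : ℤ) ∣ γ 1 0 := hg ▸ Int.gcd_dvd_right ..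
  lift t to ℕ using by
    by_contra! h
    have : (g : ℤ) * t ≤ 0 := by nlinarith
    omega
  have htN : t * g = N := by
    zify; linarith
  have ht0 : 0 < t := Nat.pos_of_ne_zero (by rintro rfl; simp at htN; omega)
  have htc : IsCoprime (t : ℤ) c := by
    rw [Int.isCoprime_iff_gcd_eq_one]
    have : Int.gcd (g * t) (g * c) = g := by rw [← ht, ← hc, ← hg]
    rw [Int.gcd_mul_left, Int.natAbs_natCast] at this
    exact Nat.eq_of_mul_eq_mul_left hg0 (by linarith)
  have hdet := γ.det_coe
  rw [Matrix.det_fin_two] at hdet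
  have hac : IsCoprime (γ 0 0) c := ⟨γ 1 1, -(γ 0 1 * g), by rw [hc] at hdet; linarith⟩
  obtain ⟨x, y, hxy⟩ := htc.mul_left hac
  refine ⟨t, g, x * N * γ 0 1 + y * γ 1 1, ht0, htN, ?_, fun τ w hw => ?_⟩
  · rw [Gamma0_mem, ZMod.intCast_zmod_eq_zero_iff_dvd]
    constructor
    · intro h
      rw [Int.gcd_eq_natAbs_left h, Int.natAbs_natCast] at hg
      rw [hg] at htN
      exact Nat.eq_of_mul_eq_mul_right hN (by linarith)
    · rintro rfl
      rw [← htN, hc]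
      simp
  · let γ' : SL(2, ℤ) := ⟨!![x, y; -c, t * γ 0 0], by
      rw [Matrix.det_fin_two_of]
      linarith⟩
    have hden : denom γ τ ≠ 0 := denom_ne_zero _ τ
    rw [ModularGroup.denom_apply] at hden
    have hcC : ((γ 1 0 : ℤ) : ℂ) = g * c := by exact_mod_cast congrArg (Int.cast : ℤ → ℂ) hc
    have hNC : (N : ℂ) = t * g := by exact_mod_cast htN.symm
    have hdetC : ((γ 0 0 : ℤ) : ℂ) * (γ 1 1 : ℤ) - (γ 0 1 : ℤ) * (γ 1 0 : ℤ) = 1 := by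
      exact_mod_cast congrArg (Int.cast : ℤ → ℂ) hdet
    have hxyC : (x : ℂ) * (t * (γ 0 0 : ℤ)) + y * c = 1 := by exact_mod_cast hxy
    have ht0C : (t : ℂ) ≠ 0 := by exact_mod_cast ht0.ne'
    have hsmul : (natMul N (γ • τ) : ℂ) =
        N * (((γ 0 0 : ℤ) * τ + (γ 0 1 : ℤ)) / ((γ 1 0 : ℤ) * τ + (γ 1 1 : ℤ))) := by
      rw [coe_natMul, coe_specialLinearGroup_apply]
      simp
    have hden' : denom γ' (natMul N (γ • τ)) = t / denom γ τ := by
      rw [ModularGroup.denom_apply, ModularGroup.denom_apply, hsmul, eq_div_iff hden, add_mul,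
        mul_assoc, mul_assoc, div_mul_cancel₀ _ hden]
      simp [γ']
      rw [hcC, hNC]
      rw [hcC] at hdetC
      linear_combination (t : ℂ) * hdetC
    have hw' : γ' • natMul N (γ • τ) = w := by
      ext1
      have h1 : ((γ' • natMul N (γ • τ) : ℍ) : ℂ) * denom γ' (natMul N (γ • τ)) =
          x * natMul N (γ • τ) + y := by
        rw [coe_specialLinearGroup_apply, ModularGroup.denom_apply]
        have := denom_ne_zero γ' (natMul N (γ • τ))
        rw [ModularGroup.denom_apply] at this
        refine (div_mul_cancel₀ _ this).trans ?_
        simp [γ']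
      rw [hden', ModularGroup.denom_apply, hsmul] at h1
      rw [hw]
      field_simp at h1 ⊢
      rw [h1]
      push_cast
      rw [hcC, hNC]
      linear_combination (g : ℂ) * τ * hxyC
    have h := isTranslate_discriminant γ' (natMul N (γ • τ))
    rw [hden', hw'] at h
    rw [h]
    have : (t : ℂ) ≠ 0 := by exact_mod_cast ht0.ne'
    field_simp

lemma mdifferentiable_comp_natMul {F : ℍ → ℂ} (hF : MDiff F) (N : ℕ) [NeZero N] :
    MDiff (fun τ => F (natMul N τ)) := by
  rw [UpperHalfPlane.mdifferentiable_iff] at hF ⊢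
  have hmaps : Set.MapsTo (fun w : ℂ => (N : ℂ) * w) {z | 0 < z.im} {z | 0 < z.im} := by
    intro w hw
    simpa using mul_pos (Nat.cast_pos.mpr (NeZero.pos N)) hw
  refine (hF.comp (differentiable_id.const_mul (N : ℂ)).differentiableOn hmaps).congr ?_
  intro w hw
  simp only [Function.comp_apply]
  rw [ofComplex_apply_of_im_pos hw, ofComplex_apply_of_im_pos (hmaps hw)]
  rfl

/-- The eta quotient `Δ(τ)^N / Δ(Nτ)`. -/
noncomputable def discriminantQuotient (N : ℕ) [NeZero N] (τ : ℍ) : ℂ :=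
  ModularForm.discriminant τ ^ N / ModularForm.discriminant (natMul N τ)

lemma mdifferentiable_discriminant : MDiff ModularForm.discriminant :=
  CuspFormClass.holo CuspForm.discriminant

lemma mdifferentiable_discriminantQuotient (N : ℕ) [NeZero N] :
    MDiff (discriminantQuotient N) := by
  have h1 := mdifferentiable_discriminant
  have h2 := mdifferentiable_comp_natMul h1 N
  rw [UpperHalfPlane.mdifferentiable_iff] at h1 h2 ⊢
  exact (h1.pow N).div h2 fun w _ => ModularForm.discriminant_ne_zero _

lemma isTranslate_discriminantQuotient_of_mem {N : ℕ} [NeZero N] {γ : SL(2, ℤ)}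
    (hγ : γ ∈ Gamma0 N) :
    IsTranslate γ (12 * (N - 1)) (discriminantQuotient N) (discriminantQuotient N) := by
  refine IsTranslate.div (l := 12) ?_ ?_
  · have h := (isTranslate_discriminant γ).pow N
    rwa [show 12 * N = 12 * (N - 1) + 12 by have := NeZero.pos N; omega] at h
  · intro τ
    obtain ⟨t, g, b, -, htg, hmem, h⟩ := discriminant_natMul_smul (N := N) γ
    obtain rfl := hmem.mp hγ
    rw [one_mul] at htg
    subst htg
    beta_reduce
    have hpos : 0 < ((natMul g τ : ℂ) + b).im := by simpa using (natMul g τ).im_pos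
    rw [h τ ⟨_, hpos⟩ (by simp), discriminant_of_coe_eq_add_int (z := natMul g τ) b rfl]
    simp

lemma exists_isTranslate_discriminantQuotient {N : ℕ} [NeZero N] {γ : SL(2, ℤ)}
    (hγ : γ ∉ Gamma0 N) :
    ∃ G, IsTranslate γ (12 * (N - 1)) (discriminantQuotient N) G ∧
      G =O[atImInfty] fun τ : ℍ => Real.exp (-2 * Real.pi * (3 * N / 4) * τ.im) := by
  obtain ⟨t, g, b, ht, htg, hmem, h⟩ := discriminant_natMul_smul (N := N) γ
  have ht2 : 2 ≤ t := by
    have : t ≠ 1 := mt hmem.mpr hγ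
    omega
  have hg : 0 < g := Nat.pos_of_ne_zero (by rintro rfl; exact NeZero.ne N (by simpa using htg.symm))
  have him (τ : ℍ) : (((g : ℂ) * τ + b) / t).im = g / t * τ.im := by
    rw [← Complex.ofReal_natCast t, Complex.div_ofReal_im]
    simp
    ring
  have ht' : (0 : ℝ) < t := by exact_mod_cast ht
  have hg' : (0 : ℝ) < g := by exact_mod_cast hg
  let w (τ : ℍ) : ℍ := ⟨(g * τ + b) / t, by
    rw [him]
    have := τ.im_pos
    positivity⟩
  have hwim (τ : ℍ) : (w τ).im = g / t * τ.im := him τ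
  have hwt : Tendsto w atImInfty atImInfty := by
    rw [atImInfty, tendsto_comap_iff]
    exact (tendsto_comap.const_mul_atTop (by positivity : (0 : ℝ) < g / t)).congr
      fun τ => (hwim τ).symm
  refine ⟨fun τ => ModularForm.discriminant τ ^ N / (ModularForm.discriminant (w τ) / t ^ 12),
    IsTranslate.div (l := 12) ?_ fun τ => h τ (w τ) rfl, ?_⟩
  · have h := (isTranslate_discriminant γ).pow N
    rwa [show 12 * N = 12 * (N - 1) + 12 by have := NeZero.pos N; omega] at h
  have h1 : (fun τ : ℍ => ModularForm.discriminant τ) =O[atImInfty]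
      fun τ => Real.exp (-2 * Real.pi * τ.im) := by
    simpa using CuspFormClass.exp_decay_atImInfty CuspForm.discriminant (h := 1) one_pos
      one_mem_strictPeriods_SL
  have h2 := ModularForm.exp_isBigO_discriminant.comp_tendsto hwt
  have h3 := h2.inv_rev (.of_forall fun τ hτ => absurd hτ (Real.exp_ne_zero _))
  have h4 := ((h1.pow N).mul h3).mul (isBigO_const_const ((t : ℂ) ^ 12) (one_ne_zero' ℝ) atImInfty)
  refine (h4.congr_left fun τ => ?_).trans (.of_bound 1 (.of_forall fun τ => ?_))
  · simp only [Function.comp_apply]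
    field_simp
  · simp only [Function.comp_apply]
    rw [mul_one, one_mul, ← Real.exp_nat_mul, ← Real.exp_neg, ← Real.exp_add,
      Real.norm_of_nonneg (Real.exp_nonneg _), Real.norm_of_nonneg (Real.exp_nonneg _),
      Real.exp_le_exp, hwim]
    have hy := mul_pos Real.pi_pos τ.im_pos
    have hle : (g : ℝ) / t ≤ N / 4 := by
      rw [← htg, div_le_div_iff₀ ht' (by norm_num)]
      have : (2 : ℝ) ≤ t := by exact_mod_cast ht2
      push_cast
      nlinarith [mul_le_mul this this (by norm_num) ht'.le]
    nlinarith [mul_le_mul_of_nonneg_left hle hy.le]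

lemma norm_prod_one_sub_pow_le {x : ℂ} (hx : ‖x‖ < 1) (k n : ℕ) :
    ‖∏ i ∈ Finset.range n, (1 - x ^ (k + i + 1))‖ ≤ Real.exp (1 - ‖x‖)⁻¹ := by
  calc ‖∏ i ∈ Finset.range n, (1 - x ^ (k + i + 1))‖
      ≤ ∏ i ∈ Finset.range n, Real.exp (‖x‖ ^ i) := by
        rw [norm_prod]
        refine Finset.prod_le_prod (fun _ _ => norm_nonneg _) fun i _ => ?_
        refine (norm_sub_le _ _).trans ?_
        rw [norm_one, norm_pow, add_comm]
        refine le_trans ?_ (Real.add_one_le_exp _)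
        have := pow_le_pow_of_le_one (norm_nonneg x) hx.le (by omega : i ≤ k + i + 1)
        linarith
    _ = Real.exp (∑ i ∈ Finset.range n, ‖x‖ ^ i) := (Real.exp_sum _ _).symm
    _ ≤ _ := by
        rw [Real.exp_le_exp, ← tsum_geometric_of_lt_one (norm_nonneg x) hx]
        exact (summable_geometric_of_lt_one (norm_nonneg x) hx).sum_le_tsum _
          fun i _ => by positivity

lemma hasSum_pentagonalSeries_complex {x : ℂ} (hx : ‖x‖ < 1) :
    HasSum (fun n : ℕ => ((PowerSeries.pentagonalSeries ℤ).coeff n : ℂ) * x ^ n)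
      (∏' n : ℕ, (1 - x ^ (n + 1))) := by
  have hr := summable_geometric_of_lt_one (norm_nonneg x) hx
  have hcoeff (n : ℕ) : ‖((PowerSeries.pentagonalSeries ℤ).coeff n : ℂ)‖ ≤ 1 := by
    by_cases hn : n ∈ Set.range pentagonal
    · obtain ⟨k, rfl⟩ := hn
      rw [PowerSeries.coeff_pentagonalSeries_pentagonal]
      rcases Int.even_or_odd k with h | h <;> simp [h]
    · simp [PowerSeries.coeff_pentagonalSeries_eq_zero ℤ hn]
  have hs : Summable fun n : ℕ => ((PowerSeries.pentagonalSeries ℤ).coeff n : ℂ) * x ^ n := by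
    refine .of_norm_bounded hr fun n => ?_
    rw [norm_mul, norm_pow]
    exact mul_le_of_le_one_left (by positivity) (hcoeff n)
  have h1 : HasSum (fun k : ℕ => (-1) ^ k * (x ^ pentagonal (-k) - x ^ pentagonal (k + 1)))
      (∑' n : ℕ, ((PowerSeries.pentagonalSeries ℤ).coeff n : ℂ) * x ^ n) := by
    have h := hs.hasSum
    rw [← pentagonal_injective.hasSum_iff fun n hn => by
      simp [PowerSeries.coeff_pentagonalSeries_eq_zero ℤ hn],
      ← neg_injective.hasSum_iff (fun x hx => by absurd hx; use -x; simp)] at h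
    convert! h.nat_add_neg_add_one using 2 with k
    simp_rw [Function.comp_apply, neg_neg, PowerSeries.coeff_pentagonalSeries_pentagonal,
      Int.negOnePow_add]
    simp
    ring
  have hbound (k n : ℕ) : ‖x ^ ((k + 1) * n) * ∏ i ∈ Finset.range (n + 1), (1 - x ^ (k + i + 1))‖ ≤
      ‖x‖ ^ n * Real.exp (1 - ‖x‖)⁻¹ := by
    rw [norm_mul, norm_pow]
    refine mul_le_mul ?_ (norm_prod_one_sub_pow_le hx _ _) (norm_nonneg _) (by positivity)
    exact pow_le_pow_of_le_one (norm_nonneg x) hx.le (Nat.le_mul_of_pos_left _ (by omega))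
  have hsum := hr.mul_right (Real.exp (1 - ‖x‖)⁻¹)
  rw [Pentagonal.tprod_one_sub_pow (tendsto_pow_atTop_nhds_zero_of_norm_lt_one hx)
    (fun k => .of_norm_bounded hsum (hbound k)) (fun k => ?_) h1.summable ?_, h1.tsum_eq]
  · exact hs.hasSum
  · rw [tendsto_zero_iff_norm_tendsto_zero]
    refine squeeze_zero (fun _ => norm_nonneg _) (fun k => ?_)
      (g := fun k => ‖x‖ ^ k * ∑' n, ‖x‖ ^ n * Real.exp (1 - ‖x‖)⁻¹) ?_
    · rw [norm_mul, norm_mul, norm_pow, norm_neg, norm_one, one_pow, one_mul, norm_pow]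
      refine mul_le_mul ?_ (tsum_of_norm_bounded hsum.hasSum (hbound k)) (norm_nonneg _)
        (by positivity)
      refine pow_le_pow_of_le_one (norm_nonneg x) hx.le ?_
      rw [Nat.le_div_iff_mul_le two_pos]
      nlinarith
    · simpa using (tendsto_pow_atTop_nhds_zero_of_lt_one (norm_nonneg x) hx).mul_const _
  · simp_rw [sub_eq_add_neg]
    refine multipliable_one_add_of_summable (f := fun n ↦ -x ^ (n + k + 1)) ?_
    simpa [add_assoc] using (summable_nat_add_iff (k + 1)).mpr hr

/-- The power series `∏ (1 - q ^ n) ^ 24`. -/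
noncomputable def eulerSeries : ℤ⟦X⟧ := PowerSeries.pentagonalSeries ℤ ^ 24

lemma coeff_zero_eulerSeries : eulerSeries.coeff 0 = 1 := by
  have : (PowerSeries.pentagonalSeries ℤ).coeff 0 = 1 := by
    have h := PowerSeries.coeff_pentagonalSeries_pentagonal ℤ 0
    rwa [show pentagonal 0 = 0 from rfl, Int.negOnePow_zero, Units.val_one, Int.cast_one] at h
  rw [PowerSeries.coeff_zero_eq_constantCoeff_apply] at this
  simp [eulerSeries, this]

/-- The function `Δ(τ) / q`. -/
noncomputable def discriminantDivQ (τ : ℍ) : ℂ :=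
  ModularForm.discriminant τ / Function.Periodic.qParam 1 τ

lemma hasQSeries_discriminantDivQ :
    HasQSeries (eulerSeries.map (Int.castRingHom ℂ)) discriminantDivQ := by
  have h : HasQSeries ((PowerSeries.pentagonalSeries ℤ).map (Int.castRingHom ℂ))
      (fun τ => ∏' n : ℕ, (1 - Function.Periodic.qParam 1 (τ : ℂ) ^ (n + 1))) := fun τ => by
    simpa using hasSum_pentagonalSeries_complex (UpperHalfPlane.norm_qParam_lt_one 1 τ)
  rw [eulerSeries, map_pow]
  have heq : discriminantDivQ = fun τ : ℍ =>
      (∏' n : ℕ, (1 - Function.Periodic.qParam 1 (τ : ℂ) ^ (n + 1))) ^ 24 := by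
    ext τ
    rw [discriminantDivQ, ModularForm.discriminant_eq_q_prod,
      mul_div_cancel_left₀ _ (show Function.Periodic.qParam 1 (τ : ℂ) ≠ 0 from
        Complex.exp_ne_zero _)]
    exact (ModularForm.multipliable_one_sub_pow
      (by simpa using UpperHalfPlane.norm_qParam_lt_one 1 τ)).tprod_pow 24
  rw [heq]
  exact h.pow 24

/-- `F` is the sum of the integral power series `φ` evaluated at `q = exp (2πiτ)`. -/
def HasIntQSeries (φ : ℤ⟦X⟧) (F : ℍ → ℂ) : Prop :=
  HasQSeries (φ.map (Int.castRingHom ℂ)) F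

namespace HasIntQSeries

variable {φ ψ : ℤ⟦X⟧} {F G : ℍ → ℂ}

lemma mul (hF : HasIntQSeries φ F) (hG : HasIntQSeries ψ G) :
    HasIntQSeries (φ * ψ) (fun τ => F τ * G τ) := by
  rw [HasIntQSeries, map_mul]
  exact HasQSeries.mul hF hG

lemma pow (hF : HasIntQSeries φ F) (n : ℕ) : HasIntQSeries (φ ^ n) (fun τ => F τ ^ n) := by
  rw [HasIntQSeries, map_pow]
  exact HasQSeries.pow hF n

lemma comp_natMul (hF : HasIntQSeries φ F) (N : ℕ) [NeZero N] :
    HasIntQSeries (φ.expand N (NeZero.ne N)) (fun τ => F (natMul N τ)) := fun τ => by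
  refine ((mul_right_injective₀ (NeZero.ne N)).hasSum_iff ?_).mp ?_
  rotate_left
  · refine (hF (natMul N τ)).congr_fun fun n => ?_
    simp only [Function.comp_apply, PowerSeries.coeff_map, PowerSeries.coeff_expand_mul]
    rw [pow_mul, Function.Periodic.qParam, Function.Periodic.qParam, ← Complex.exp_nat_mul,
      coe_natMul]
    congr 3
    push_cast
    ring
  · intro n hn
    rw [PowerSeries.coeff_map, PowerSeries.coeff_expand_of_not_dvd, map_zero, zero_mul]
    rintro ⟨k, rfl⟩
    exact hn ⟨k, rfl⟩

lemma tendsto_coeff_zero (hF : HasIntQSeries φ F) :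
    Tendsto F atImInfty (𝓝 (φ.coeff 0 : ℂ)) := by
  simpa using HasQSeries.tendsto_div_qParam_pow hF (M := 0) (by simp)

end HasIntQSeries

lemma hasIntQSeries_qParam :
    HasIntQSeries PowerSeries.X (fun τ => Function.Periodic.qParam 1 (τ : ℂ)) := fun τ => by
  convert hasSum_single (f := fun n : ℕ => (PowerSeries.X.map (Int.castRingHom ℂ)).coeff n *
    Function.Periodic.qParam 1 (τ : ℂ) ^ n) 1 ?_ using 1
  · simp
  · intro n hn
    simp [PowerSeries.coeff_X, hn]

lemma hasIntQSeries_discriminant :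
    HasIntQSeries (PowerSeries.X * eulerSeries) ModularForm.discriminant := by
  convert hasIntQSeries_qParam.mul hasQSeries_discriminantDivQ using 1
  ext τ
  exact (mul_div_cancel₀ _ (Complex.exp_ne_zero _)).symm

lemma discriminantDivQ_ne_zero (τ : ℍ) : discriminantDivQ τ ≠ 0 :=
  div_ne_zero (ModularForm.discriminant_ne_zero τ) (Complex.exp_ne_zero _)

lemma discriminantQuotient_mul_discriminantDivQ (N : ℕ) [NeZero N] (τ : ℍ) :
    discriminantQuotient N τ * discriminantDivQ (natMul N τ) = discriminantDivQ τ ^ N := by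
  have h : Function.Periodic.qParam 1 (natMul N τ : ℂ) = Function.Periodic.qParam 1 (τ : ℂ) ^ N := by
    rw [Function.Periodic.qParam, Function.Periodic.qParam, ← Complex.exp_nat_mul, coe_natMul]
    congr 1
    push_cast
    ring
  have h1 : Function.Periodic.qParam 1 (τ : ℂ) ≠ 0 := Complex.exp_ne_zero _
  have h2 := ModularForm.discriminant_ne_zero (natMul N τ)
  rw [discriminantQuotient, discriminantDivQ, discriminantDivQ, h]
  field_simp
  rw [div_pow, mul_div_cancel₀ _ (pow_ne_zero _ h1)]

/-- The `q`-expansion of `E₄`. -/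
def eisensteinFourSeries : ℤ⟦X⟧ :=
  PowerSeries.mk fun n => if n = 0 then 1 else 240 * ArithmeticFunction.sigma 3 n

lemma hasIntQSeries_E₄ : HasIntQSeries eisensteinFourSeries ModularForm.E₄ := by
  have h : eisensteinFourSeries.map (Int.castRingHom ℂ) = qExpansion 1 ModularForm.E₄ := by
    ext n
    rw [EisensteinSeries.E_qExpansion_coeff _ ⟨2, rfl⟩]
    norm_num [eisensteinFourSeries, show bernoulli 4 = -1 / 30 by decide +kernel]
  rw [HasIntQSeries, h]
  exact ModularForm.hasQSeries _

lemma coeff_zero_eisensteinFourSeries : eisensteinFourSeries.coeff 0 = 1 := by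
  simp only [eisensteinFourSeries, PowerSeries.coeff_mk, if_pos]

lemma det_ne_zero_of_order_eq (p : ℕ) [Fact p.Prime] {n : ℕ} (ψ : Fin n → ℤ⟦X⟧)
    (h : ∀ j, ((ψ j).map (Int.castRingHom (ZMod p))).order = (j : ℕ)) :
    (Matrix.of fun i j : Fin n => (ψ j).coeff (i : ℕ)).det ≠ 0 := by
  intro h0
  have h1 := congrArg (Int.castRingHom (ZMod p)) h0
  rw [RingHom.map_det, map_zero, Matrix.det_of_isLowerTriangular, Finset.prod_eq_zero_iff] at h1
  · obtain ⟨i, -, hi⟩ := h1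
    refine (PowerSeries.order_eq_nat.mp (h i)).1 ?_
    simpa using hi
  · intro i j hij
    have := PowerSeries.coeff_of_lt_order (φ := (ψ j).map (Int.castRingHom (ZMod p))) (i : ℕ)
      (by rw [h j]; exact_mod_cast hij)
    simpa using this

lemma exists_sum_coeff_eq (p : ℕ) [Fact p.Prime] {n : ℕ} (ψ : Fin (n + 1) → ℤ⟦X⟧)
    (h : ∀ j, ((ψ j).map (Int.castRingHom (ZMod p))).order = (j : ℕ)) :
    ∃ x : Fin (n + 1) → ℂ,
      (∀ i < n, (∑ j, PowerSeries.C (x j) * (ψ j).map (Int.castRingHom ℂ)).coeff i = 0) ∧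
      (∑ j, PowerSeries.C (x j) * (ψ j).map (Int.castRingHom ℂ)).coeff n = 1 := by
  let A : Matrix (Fin (n + 1)) (Fin (n + 1)) ℂ :=
    (Int.castRingHom ℂ).mapMatrix (Matrix.of fun i j => (ψ j).coeff (i : ℕ))
  have hA : IsUnit A.det := by
    rw [isUnit_iff_ne_zero, ← RingHom.map_det]
    simpa using det_ne_zero_of_order_eq p ψ h
  let x := A⁻¹.mulVec (Pi.single (Fin.last n) 1)
  have hx : A.mulVec x = Pi.single (Fin.last n) 1 := by
    rw [Matrix.mulVec_mulVec, Matrix.mul_nonsing_inv _ hA, Matrix.one_mulVec]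
  have hc (i : Fin (n + 1)) :
      (∑ j, PowerSeries.C (x j) * (ψ j).map (Int.castRingHom ℂ)).coeff (i : ℕ) =
        (Pi.single (Fin.last n) 1 : Fin (n + 1) → ℂ) i := by
    rw [← hx, Matrix.mulVec, dotProduct, map_sum]
    refine Finset.sum_congr rfl fun j _ => ?_
    simp [A, mul_comm]
  refine ⟨x, fun i hi => ?_, ?_⟩
  · have := hc ⟨i, by omega⟩
    rwa [Pi.single_eq_of_ne (by simp [Fin.ext_iff]; omega)] at this
  · simpa using hc (Fin.last n)

section ExpDecay

variable {F G : ℍ → ℂ} {a b : ℝ}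

lemma isBigO_exp_mul (hF : F =O[atImInfty] fun τ : ℍ => Real.exp (-2 * Real.pi * a * τ.im))
    (hG : G =O[atImInfty] fun τ : ℍ => Real.exp (-2 * Real.pi * b * τ.im)) :
    (fun τ => F τ * G τ) =O[atImInfty] fun τ : ℍ => Real.exp (-2 * Real.pi * (a + b) * τ.im) := by
  refine (hF.mul hG).congr_right fun τ => ?_
  rw [← Real.exp_add]
  ring_nf

lemma isBigO_exp_pow (hF : F =O[atImInfty] fun τ : ℍ => Real.exp (-2 * Real.pi * a * τ.im))
    (n : ℕ) :
    (fun τ => F τ ^ n) =O[atImInfty] fun τ : ℍ => Real.exp (-2 * Real.pi * (n * a) * τ.im) := by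
  refine (hF.pow n).congr_right fun τ => ?_
  rw [← Real.exp_nat_mul]
  ring_nf

lemma isBigO_exp_mono (hF : F =O[atImInfty] fun τ : ℍ => Real.exp (-2 * Real.pi * a * τ.im))
    (hab : b ≤ a) : F =O[atImInfty] fun τ : ℍ => Real.exp (-2 * Real.pi * b * τ.im) := by
  refine hF.trans (.of_norm_le fun τ => ?_)
  rw [Real.norm_of_nonneg (Real.exp_pos _).le, Real.exp_le_exp]
  have := mul_le_mul_of_nonneg_right hab (mul_pos Real.two_pi_pos τ.im_pos).le
  linarith

end ExpDecay

/-- The monomial `H ^ (e * a) * U ^ (L - a) * Δ ^ i * E₄ ^ (3 * (M - i))`, where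
`j = M * a + i` with `i < M`. -/
noncomputable def sturmMonomial (e L M : ℕ) (H U : ℍ → ℂ) (j : ℕ) (τ : ℍ) : ℂ :=
  H τ ^ (e * (j / M)) * U τ ^ (L - j / M) *
    (ModularForm.discriminant τ ^ (j % M) * ModularForm.E₄ τ ^ (3 * (M - j % M)))

section

variable {e L M j : ℕ} {H U H' U' : ℍ → ℂ}

lemma isTranslate_sturmMonomial {γ : SL(2, ℤ)} (hj : j < M * L) (hH : IsTranslate γ 2 H H')
    (hU : IsTranslate γ (2 * e) U U') :
    IsTranslate γ (2 * e * L + 12 * M) (sturmMonomial e L M H U j)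
      (sturmMonomial e L M H' U' j) := by
  have hM : 0 < M := Nat.pos_of_ne_zero (by rintro rfl; simp at hj)
  have hE : IsTranslate γ 4 ModularForm.E₄ ModularForm.E₄ :=
    isTranslate_of_levelOne (k := 4) ModularForm.E₄ γ
  have h := ((hH.pow (e * (j / M))).mul (hU.pow (L - j / M))).mul
    (((isTranslate_discriminant γ).pow (j % M)).mul (hE.pow (3 * (M - j % M))))
  have ha : j / M < L := Nat.div_lt_of_lt_mul hj
  obtain ⟨b, hb⟩ := Nat.exists_eq_add_of_lt ha
  obtain ⟨i, hi⟩ := Nat.exists_eq_add_of_lt (Nat.mod_lt j hM)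
  convert! h using 1
  generalize j / M = x at *
  generalize j % M = y at *
  subst hb hi
  rw [show x + b + 1 - x = b + 1 by omega, show y + i + 1 - y = i + 1 by omega]
  ring

lemma mdifferentiable_sturmMonomial (hH : MDiff H) (hU : MDiff U) :
    MDiff (sturmMonomial e L M H U j) := by
  have hE : MDiff (ModularForm.E₄ : ℍ → ℂ) := ModularFormClass.holo ModularForm.E₄
  have hD := mdifferentiable_discriminant
  rw [UpperHalfPlane.mdifferentiable_iff] at hH hU hE hD ⊢
  exact ((hH.pow _).mul (hU.pow _)).mul ((hD.pow _).mul (hE.pow _))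

lemma isBigO_sturmMonomial (hj : j < M * L) {t : ℝ}
    (hH : H =O[atImInfty] fun τ : ℍ => Real.exp (-2 * Real.pi * t * τ.im))
    (hU : U =O[atImInfty] fun τ : ℍ => Real.exp (-2 * Real.pi * (e * t) * τ.im)) :
    sturmMonomial e L M H U j =O[atImInfty]
      fun τ : ℍ => Real.exp (-2 * Real.pi * (e * L * t) * τ.im) := by
  have h0 {φ : ℤ⟦X⟧} {F : ℍ → ℂ} (hF : HasIntQSeries φ F) :
      F =O[atImInfty] fun τ : ℍ => Real.exp (-2 * Real.pi * 0 * τ.im) := by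
    simpa using HasQSeries.isBigO hF (M := 0) (by simp)
  have h := isBigO_exp_mul (isBigO_exp_mul (isBigO_exp_pow hH (e * (j / M)))
      (isBigO_exp_pow hU (L - j / M)))
    (isBigO_exp_mul (isBigO_exp_pow (h0 hasIntQSeries_discriminant) (j % M))
      (isBigO_exp_pow (h0 hasIntQSeries_E₄) (3 * (M - j % M))))
  refine isBigO_exp_mono h (le_of_eq ?_)
  have ha : j / M < L := Nat.div_lt_of_lt_mul hj
  obtain ⟨b, hb⟩ := Nat.exists_eq_add_of_lt ha
  generalize j / M = x at *
  subst hb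
  rw [show x + b + 1 - x = b + 1 by omega]
  push_cast
  ring

end

/-- The `q`-expansion of `sturmMonomial` times a power of `Δ(Nτ) / q ^ N`. -/
noncomputable def sturmSeries (N : ℕ) [NeZero N] (e L M : ℕ) (α : ℤ⟦X⟧) (j : ℕ) : ℤ⟦X⟧ :=
  α ^ (e * (j / M)) * (eulerSeries ^ N) ^ (L - j / M) *
    eulerSeries.expand N (NeZero.ne N) ^ (j / M) *
    ((PowerSeries.X * eulerSeries) ^ (j % M) * eisensteinFourSeries ^ (3 * (M - j % M)))

lemma hasIntQSeries_sturmMonomial_mul {N : ℕ} [NeZero N] {e L M j : ℕ} {α : ℤ⟦X⟧} {H : ℍ → ℂ}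
    (hα : HasIntQSeries α H) (hj : j < M * L) :
    HasIntQSeries (sturmSeries N e L M α j) (fun τ =>
      sturmMonomial e L M H (discriminantQuotient N) j τ * discriminantDivQ (natMul N τ) ^ L) := by
  have hP : HasIntQSeries eulerSeries discriminantDivQ := hasQSeries_discriminantDivQ
  have h := ((((hα.pow (e * (j / M))).mul ((hP.pow N).pow (L - j / M))).mul
    ((hP.comp_natMul N).pow (j / M)))).mul
    ((hasIntQSeries_discriminant.pow (j % M)).mul (hasIntQSeries_E₄.pow (3 * (M - j % M))))
  convert! h using 1
  ext τ
  rw [sturmMonomial, ← discriminantQuotient_mul_discriminantDivQ N]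
  have ha : j / M < L := Nat.div_lt_of_lt_mul hj
  obtain ⟨b, hb⟩ := Nat.exists_eq_add_of_lt ha
  generalize j / M = x at *
  subst hb
  rw [show x + b + 1 - x = b + 1 by omega]
  ring

lemma order_eq_zero_of_coeff_zero_eq_one {R : Type*} [Semiring R] [Nontrivial R] {φ : R⟦X⟧}
    (h : φ.coeff 0 = 1) : φ.order = 0 := by
  have := (PowerSeries.order_eq_nat (φ := φ) (n := 0)).mpr (by
    simp [-PowerSeries.coeff_zero_eq_constantCoeff, h])
  simpa using this

lemma order_sturmSeries (p : ℕ) [Fact p.Prime] {N : ℕ} [NeZero N] {e L s j : ℕ} {α : ℤ⟦X⟧}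
    (hα : (α.map (Int.castRingHom (ZMod p))).order = s) :
    ((sturmSeries N e L (s * e) α j).map (Int.castRingHom (ZMod p))).order = j := by
  have h1 : (eulerSeries.map (Int.castRingHom (ZMod p))).order = 0 :=
    order_eq_zero_of_coeff_zero_eq_one (by
      rw [PowerSeries.coeff_map, coeff_zero_eulerSeries, map_one])
  have h2 : (eisensteinFourSeries.map (Int.castRingHom (ZMod p))).order = 0 :=
    order_eq_zero_of_coeff_zero_eq_one (by
      rw [PowerSeries.coeff_map, coeff_zero_eisensteinFourSeries, map_one])
  simp only [sturmSeries, map_mul, map_pow, PowerSeries.order_mul, PowerSeries.order_pow,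
    PowerSeries.map_expand, PowerSeries.order_expand, h1, h2, hα, PowerSeries.map_X,
    PowerSeries.order_X, smul_zero, add_zero]
  rw [nsmul_eq_mul, nsmul_eq_mul, mul_one]
  norm_cast
  conv_rhs => rw [← Nat.div_add_mod j (s * e)]
  ring

lemma MDiff.sum_const_mul {ι : Type*} (s : Finset ι) (x : ι → ℂ) {F : ι → ℍ → ℂ}
    (hF : ∀ i ∈ s, MDiff (F i)) : MDiff (fun τ => ∑ i ∈ s, x i * F i τ) := by
  simp only [UpperHalfPlane.mdifferentiable_iff] at hF ⊢
  exact DifferentiableOn.fun_sum fun i hi => (hF i hi).const_mul (x i)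

lemma one_le_index_gamma0 (N : ℕ) [NeZero N] : (1 : ℝ) ≤ (Gamma0 N).index :=
  Nat.one_le_cast.mpr (Nat.one_le_iff_ne_zero.mpr Subgroup.FiniteIndex.index_ne_zero)

theorem map_zmod_eq_zero_of_seven_le (p : ℕ) [Fact p.Prime] {N : ℕ} [NeZero N] (hN : 7 ≤ N)
    (f : CuspForm (Gamma0 N) 2) {α : ℤ⟦X⟧} (hα : HasIntQSeries α f)
    (hd : ∀ n : ℕ, (n : ℝ) ≤ (Gamma0 N).index / 6 - ((Gamma0 N).index - 1) / N →
      (p : ℤ) ∣ α.coeff n) : α.map (Int.castRingHom (ZMod p)) = 0 := by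
  by_contra hne
  obtain ⟨s, hs⟩ := ENat.ne_top_iff_exists.mp (PowerSeries.order_eq_top.not.mpr hne)
  have hm := one_le_index_gamma0 N
  have hN' : (7 : ℝ) ≤ N := by exact_mod_cast hN
  obtain ⟨m, hm_def⟩ : ∃ m : ℝ, m = (Gamma0 N).index := ⟨_, rfl⟩
  rw [← hm_def] at hd hm
  have hsX : m / 6 - (m - 1) / N < s := by
    by_contra! hle
    refine (PowerSeries.order_eq_nat.mp hs.symm).1 ?_
    rw [PowerSeries.coeff_map]
    exact (ZMod.intCast_zmod_eq_zero_iff_dvd _ _).mpr (hd s hle)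
  have hs0 : 0 < s := by
    have : (m - 1) / N ≤ m / 6 := by
      rw [div_le_div_iff₀ (by linarith) (by norm_num)]
      nlinarith
    have : (0 : ℝ) < s := by linarith
    exact_mod_cast this
  obtain ⟨e, he⟩ : ∃ e, e = 6 * (N - 1) := ⟨_, rfl⟩
  have he0 : 0 < e := by omega
  have he' : (e : ℝ) = 6 * (N - 1) := by
    rw [he, Nat.cast_mul, Nat.cast_sub (by omega)]
    norm_num
  obtain ⟨L, hL⟩ := exists_nat_gt ((1 + s * e * m) / (e * (s - (m / 6 - (m - 1) / N))))
  have hs0' : (0 : ℝ) < s := by exact_mod_cast hs0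
  have he0' : (0 : ℝ) < e := by exact_mod_cast he0
  rw [div_lt_iff₀ (mul_pos he0' (by linarith))] at hL
  have hL0 : 0 < L := by
    refine Nat.pos_of_ne_zero ?_
    rintro rfl
    have : 0 < s * e * m := by positivity
    simp at hL
    linarith
  obtain ⟨n, hn⟩ := Nat.exists_eq_succ_of_ne_zero (by positivity : s * e * L ≠ 0)
  obtain ⟨x, hx0, hx1⟩ := exists_sum_coeff_eq p
    (fun j : Fin (n + 1) => sturmSeries N e L (s * e) α j) fun j => order_sturmSeries p hs.symm
  have hj (j : Fin (n + 1)) : (j : ℕ) < s * e * L := hn ▸ j.2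
  let F (τ : ℍ) : ℂ := ∑ j : Fin (n + 1),
    x j * sturmMonomial e L (s * e) f (discriminantQuotient N) j τ
  have hG := HasQSeries.sum Finset.univ fun (j : Fin (n + 1)) _ =>
    HasQSeries.const_mul (x j) (hasIntQSeries_sturmMonomial_mul (N := N) (e := e) hα (hj j))
  have hGF : (fun τ => ∑ j : Fin (n + 1), x j * (sturmMonomial e L (s * e) f
      (discriminantQuotient N) j τ * discriminantDivQ (natMul N τ) ^ L)) =
      fun τ => F τ * discriminantDivQ (natMul N τ) ^ L := by
    ext τ
    simp only [F, Finset.sum_mul, mul_assoc]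
  rw [hGF] at hG
  have hQ : Tendsto (fun τ : ℍ => (discriminantDivQ (natMul N τ) ^ L)⁻¹) atImInfty (𝓝 1) := by
    have h := (HasIntQSeries.comp_natMul hasQSeries_discriminantDivQ N).tendsto_coeff_zero
    rw [PowerSeries.coeff_zero_eq_constantCoeff_apply, PowerSeries.constantCoeff_expand,
      ← PowerSeries.coeff_zero_eq_constantCoeff_apply, coeff_zero_eulerSeries, Int.cast_one] at h
    simpa using (h.pow L).inv₀ (by simp)
  have hF0 : F = 0 := by
    refine eq_zero_of_isBigO_gamma0 (N := N) (k := ((2 * e * L + 12 * (s * e) : ℕ) : ℤ))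
      (t₀ := n) (t := e * L * (1 / N)) (Nat.cast_nonneg _) ?_ ?_ (Nat.cast_nonneg _)
      (by positivity) ?_ (fun γ hγ => ?_) ?_
    · refine MDiff.sum_const_mul _ _ fun j _ => ?_
      exact mdifferentiable_sturmMonomial (CuspFormClass.holo f)
        (mdifferentiable_discriminantQuotient N)
    · intro γ hγ
      refine (IsTranslate.sum _ fun j _ => (isTranslate_sturmMonomial (hj j) ?_ ?_).const_mul
        (x j)).slash_eq
      · have := IsTranslate.slash (γ := γ) (k := 2) f
        rwa [show (f : ℍ → ℂ) ∣[((2 : ℕ) : ℤ)] γ = f from f.slash_eq_of_mem_gamma0 hγ] at this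
      · rw [show 2 * e = 12 * (N - 1) by omega]
        exact isTranslate_discriminantQuotient_of_mem hγ
    · refine ((hG.isBigO hx0).mul (hQ.isBigO_one ℝ)).congr' (.of_forall fun τ => ?_)
        (.of_forall fun τ => mul_one _)
      exact mul_inv_cancel_right₀ (pow_ne_zero _ (discriminantDivQ_ne_zero _)) _
    · obtain ⟨U, hU, hUO⟩ := exists_isTranslate_discriminantQuotient hγ
      rw [show 12 * (N - 1) = 2 * e by omega] at hU
      have h := IsTranslate.sum Finset.univ fun (j : Fin (n + 1)) _ =>
        (isTranslate_sturmMonomial (hj j) (IsTranslate.slash (γ := γ) (k := 2) f) hU).const_mul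
          (x j)
      rw [h.slash_eq]
      refine IsBigO.fun_sum fun j _ => IsBigO.const_mul_left ?_ _
      refine isBigO_sturmMonomial (hj j) (f.slash_isBigO_atImInfty_gamma0 γ)
        (isBigO_exp_mono hUO ?_)
      rw [he', mul_one_div, div_le_div_iff₀ (by linarith) (by norm_num)]
      nlinarith
    · have hn' : (s : ℝ) * e * L = n + 1 := by exact_mod_cast hn
      rw [← hm_def]
      push_cast
      have : (m - 1) * (e * L * (1 / N)) = L * e * ((m - 1) / N) := by ring
      rw [this]
      nlinarith
  have h1 := hG.coeff_eq_zero (T := n + 1) (by simp [hF0, isBigO_zero]) n (by linarith)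
  exact one_ne_zero (hx1.symm.trans h1)

lemma cuspForm_gamma0_weight_two_eq_zero {N : ℕ} [NeZero N] (hN : N ≤ 6)
    (f : CuspForm (Gamma0 N) 2) : (f : ℍ → ℂ) = 0 := by
  refine eq_zero_of_isBigO_gamma0 (N := N) (k := 2) (t₀ := 1) (t := 1 / N) (by norm_num)
    (CuspFormClass.holo f) (fun γ hγ => f.slash_eq_of_mem_gamma0 hγ) zero_le_one (by positivity)
    (by simpa using f.isBigO_atImInfty_gamma0) (fun γ _ => f.slash_isBigO_atImInfty_gamma0 γ) ?_
  have hN' : (N : ℝ) ≤ 6 := by exact_mod_cast hN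
  have h : (1 : ℝ) / 6 ≤ 1 / N :=
    one_div_le_one_div_of_le (by exact_mod_cast NeZero.pos N) hN'
  have := mul_le_mul_of_nonneg_left h (sub_nonneg.mpr (one_le_index_gamma0 N))
  push_cast
  linarith

theorem map_zmod_eq_zero_of_sturm (p : ℕ) [Fact p.Prime] {N : ℕ} [NeZero N]
    (f : CuspForm (Gamma0 N) 2) {α : ℤ⟦X⟧} (hα : HasIntQSeries α f)
    (hd : ∀ n : ℕ, (n : ℝ) ≤ (Gamma0 N).index / 6 - ((Gamma0 N).index - 1) / N →
      (p : ℤ) ∣ α.coeff n) : α.map (Int.castRingHom (ZMod p)) = 0 := by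
  rcases le_or_gt N 6 with hN | hN
  · rw [HasIntQSeries, cuspForm_gamma0_weight_two_eq_zero hN f] at hα
    ext n
    have := hα.coeff_eq_zero (T := n + 1) (isBigO_zero _ _) n (by linarith)
    rw [PowerSeries.coeff_map, eq_intCast, Int.cast_eq_zero] at this
    simp [this]
  · exact map_zmod_eq_zero_of_seven_le p hN f hα hd

end

/-- If the `q`-expansion coefficients of a weight-2 integral cusp form `f` on `Γ₀(N)` agree
modulo a prime `p` with those of the `ℤ`-linear combination `c₁g₁ + ⋯ + c_r g_r` of
integral cusp forms `g₁, …, g_r` for all `1 ≤ n ≤ B`, where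
`B = ⌊ind/6 - (ind - 1)/N⌋` is the Sturm bound for `Γ₀(N)`
(with `ind = [SL₂(ℤ) : Γ₀(N)]`), then they agree modulo `p` for all `n ≥ 1`; in
particular `f` is congruent modulo `p` to a form in the `ℤ`-span of `g₁, …, g_r`.
The `q`-expansions `h(τ) = Σ_{n ≥ 1} aₙ(h) qⁿ` (with `q = exp(2πiτ)`) are encoded via
`HasSum` hypotheses; since `aₙ` is `ℤ`-linear in the form, the `n`-th coefficient of
`c₁g₁ + ⋯ + c_r g_r` is `Σᵢ cᵢ aₙ(gᵢ)`. -/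
theorem congruent_up_to_sturm_bound_implies_congruent
    (N : ℕ) (hN : 0 < N) (p : ℕ) (hp : p.Prime) (r : ℕ)
    (f : CuspForm (Gamma0 N) 2) (g : Fin r → CuspForm (Gamma0 N) 2)
    (af : ℕ → ℤ) (ag : Fin r → ℕ → ℤ)
    (haf0 : af 0 = 0) (hag0 : ∀ i, ag i 0 = 0)
    (hf : ∀ τ : ℍ, HasSum
      (fun n : ℕ => (af n : ℂ) * Complex.exp (2 * Real.pi * Complex.I * (τ : ℂ)) ^ n) (f τ))
    (hg : ∀ i, ∀ τ : ℍ, HasSum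
      (fun n : ℕ => (ag i n : ℂ) * Complex.exp (2 * Real.pi * Complex.I * (τ : ℂ)) ^ n)
      ((g i) τ))
    (B : ℤ)
    (hB : B = ⌊((Gamma0 N).index : ℚ) / 6 - (((Gamma0 N).index : ℚ) - 1) / N⌋)
    (c : Fin r → ℤ)
    (hcong : ∀ n : ℕ, 1 ≤ n → (n : ℤ) ≤ B → af n ≡ ∑ i, c i * ag i n [ZMOD p]) :
    ∀ n : ℕ, 1 ≤ n → af n ≡ ∑ i, c i * ag i n [ZMOD p] := by
  have : NeZero N := ⟨hN.ne'⟩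
  have : Fact p.Prime := ⟨hp⟩
  have hα : HasIntQSeries (PowerSeries.mk fun n => af n - ∑ i, c i * ag i n)
      (f - ∑ i, (c i : ℂ) • g i : CuspForm (Gamma0 N) 2) := fun τ => by
    have hsum := (hf τ).sub (hasSum_sum fun i (_ : i ∈ Finset.univ) => (hg i τ).mul_left (c i : ℂ))
    have h (s : Finset (Fin r)) : (∑ i ∈ s, (c i : ℂ) • g i : CuspForm (Gamma0 N) 2) τ =
        ∑ i ∈ s, (c i : ℂ) * g i τ := by
      induction s using Finset.induction_on with
      | empty => simp
      | insert a s ha ih => simp [Finset.sum_insert ha, ih]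
    rw [sub_apply, h]
    refine hsum.congr_fun fun n => ?_
    simp [Function.Periodic.qParam, sub_mul, Finset.sum_mul, mul_assoc]
  have h0 := map_zmod_eq_zero_of_sturm p _ hα fun n hn => by
    rw [PowerSeries.coeff_mk]
    rcases Nat.eq_zero_or_pos n with rfl | hn0
    · simp [haf0, hag0]
    · refine (hcong n hn0 ?_).symm.dvd
      rw [hB, Int.le_floor]
      have : ((n : ℚ) : ℝ) ≤ (((Gamma0 N).index / 6 - ((Gamma0 N).index - 1) / N : ℚ) : ℝ) := by
        push_cast
        exact hn
      exact_mod_cast this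
  intro n _
  have h := congrArg (PowerSeries.coeff n) h0
  rw [PowerSeries.coeff_map, PowerSeries.coeff_mk, map_zero] at h
  exact ((Int.modEq_iff_dvd.mpr ((ZMod.intCast_zmod_eq_zero_iff_dvd _ _).mp h))).symm
end
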